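/- Let T0 ⊆ T0 ∪ UIF_{Σ_f} ⊆ T := T0 ∪ UIF_{Σ_f} ∪ K be a chain of local theory extensions, where T0 has signature Π0, T has signature Π = Π0 ∪ Σ with Σ = Σ_f ∪ Σ_d, and K is a set of flat and linear Π-clauses in which every variable occurs below an extension symbol in Σ_d. Suppose f ∈ Σ_d is implicitly definable w.r.t. T over Π0 ∪ Σ_f. Then the (Π0 ∪ Σ_f)-formula F_f(x̄, y) obtained by applying Algorithm 1 to G = { f(a_1,…,a_n) ≈ b } with the instantiation set Ψ(est(G)) (eliminating the symbols in Σ_d), followed by (T0 ∪ UIF_{Σ_f})-uniform interpolation w.r.t. {a_1,…,a_n, b}, is an explicit definition of f: T ⊨ ∀x̄, y ( f(x̄) ≈ y ↔ F_f(x̄, y) ). -/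

import Mathlib

/- Common framework: first-order signatures with designated sets of interpreted symbols,
uninterpreted (extension) function symbols and fresh constants, clauses, flatness/linearity,
instances, locality of theory extensions, (general) uniform interpolants, and a semantic
specification of the symbol-elimination Algorithm 1 of the paper. -/

open FirstOrder FirstOrder.Language

namespace PaperSE

variable {L : FirstOrder.Language.{0, 0}}

/-- A function symbol of `L` together with its arity. Constants are the arity-0 symbols. -/
abbrev Sym (L : FirstOrder.Language.{0, 0}) : Type := Σ n : ℕ, L.Functions n

/-- Ground terms (no variables; constants are `0`-ary function symbols of `L`). -/
abbrev GTerm (L : FirstOrder.Language.{0, 0}) : Type := L.Term Empty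

/-- A ground term viewed as a term with variables from `α`. -/
def GTerm.cast {α : Type} (t : GTerm L) : L.Term α := Term.relabel Empty.elim t

/-- The term `c()` for a constant symbol `c`. -/
def constT (c : L.Functions 0) : GTerm L := Term.func c (fun j => j.elim0)

/- ### Structures, with the interpretation passed explicitly -/

def FunM (M : Type) (S : L.Structure M) {n : ℕ} (f : L.Functions n) (x : Fin n → M) : M := by
  letI := S; exact Structure.funMap f x

def RelM (M : Type) (S : L.Structure M) {n : ℕ} (r : L.Relations n) (x : Fin n → M) : Prop := by
  letI := S; exact Structure.RelMap r x

def TVal (M : Type) (S : L.Structure M) {α : Type} (v : α → M) (t : L.Term α) : M := by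
  letI := S; exact t.realize v

/-- Value of a ground term. -/
def GVal (M : Type) (S : L.Structure M) (t : GTerm L) : M :=
  TVal M S (fun e : Empty => e.elim) t

def RealizeF (M : Type) (S : L.Structure M) {α : Type} (φ : L.Formula α) (v : α → M) : Prop := by
  letI := S; exact φ.Realize v

def RealizeSent (M : Type) (S : L.Structure M) (φ : L.Sentence) : Prop :=
  RealizeF M S φ (fun e : Empty => e.elim)

def ModelsT (M : Type) (S : L.Structure M) (T : L.Theory) : Prop :=
  ∀ φ ∈ T, RealizeSent M S φ

/- ### Symbols and ground terms occurring in terms and formulas -/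

/-- The set of subterms of a term. -/
def subterms {α : Type} : L.Term α → Set (L.Term α)
  | .var a => {Term.var a}
  | .func f ts => insert (Term.func f ts) (⋃ i, subterms (ts i))

/-- The function (and constant) symbols occurring in a term. -/
def termSyms {α : Type} : L.Term α → Set (Sym L)
  | .var _ => ∅
  | .func f ts => insert ⟨_, f⟩ (⋃ i, termSyms (ts i))

/-- The list of occurrences of variables in a term. -/
def varOccs {α : Type} : L.Term α → List α
  | .var a => [a]
  | .func _ ts => (List.finRange _).flatMap (fun i => varOccs (ts i))

/-- The list of occurrences of constant symbols in a ground term. -/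
def constOccs : GTerm L → List (L.Functions 0)
  | .var e => e.elim
  | .func (l := n) f ts =>
      if h : n = 0 then [h ▸ f]
      else (List.finRange n).flatMap (fun i => constOccs (ts i))

/-- Does the term start with a function symbol from `F`? -/
def rootIn (F : Set (Sym L)) {α : Type} : L.Term α → Prop
  | .var _ => False
  | .func f _ => (⟨_, f⟩ : Sym L) ∈ F

/-- The function (and constant) symbols occurring in a bounded formula. -/
def bfSyms {α : Type} : ∀ {n : ℕ}, L.BoundedFormula α n → Set (Sym L)
  | _, .falsum => ∅
  | _, .equal t u => termSyms t ∪ termSyms u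
  | _, .rel _ ts => ⋃ i, termSyms (ts i)
  | _, .imp f g => bfSyms f ∪ bfSyms g
  | _, .all f => bfSyms f

abbrev sentSyms (s : L.Sentence) : Set (Sym L) := bfSyms s

def theorySyms (T : L.Theory) : Set (Sym L) := ⋃ s ∈ T, sentSyms s

/-- The ground terms occurring in a bounded formula. -/
def bfGTerms {α : Type} : ∀ {n : ℕ}, L.BoundedFormula α n → Set (GTerm L)
  | _, .falsum => ∅
  | _, .equal t u => {g | GTerm.cast g ∈ subterms t ∨ GTerm.cast g ∈ subterms u}
  | _, .rel _ ts => {g | ∃ i, GTerm.cast g ∈ subterms (ts i)}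
  | _, .imp f g => bfGTerms f ∪ bfGTerms g
  | _, .all f => bfGTerms f

abbrev sentGTerms (s : L.Sentence) : Set (GTerm L) := bfGTerms s

/- ### Literals and clauses -/

/-- Literals over variables `α`. -/
inductive Lit (L : FirstOrder.Language.{0, 0}) (α : Type) : Type where
  | eq (t u : L.Term α)
  | neq (t u : L.Term α)
  | rel {n : ℕ} (R : L.Relations n) (ts : Fin n → L.Term α)
  | nrel {n : ℕ} (R : L.Relations n) (ts : Fin n → L.Term α)

namespace Lit

def terms {α : Type} : Lit L α → Set (L.Term α)
  | eq t u => {t, u}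
  | neq t u => {t, u}
  | rel _ ts => Set.range ts
  | nrel _ ts => Set.range ts

/-- An atom (positive literal). -/
def Positive {α : Type} : Lit L α → Prop
  | eq _ _ => True
  | rel _ _ => True
  | _ => False

def subst {α β : Type} (σ : α → L.Term β) : Lit L α → Lit L β
  | eq t u => eq (t.subst σ) (u.subst σ)
  | neq t u => neq (t.subst σ) (u.subst σ)
  | rel R ts => rel R (fun i => (ts i).subst σ)
  | nrel R ts => nrel R (fun i => (ts i).subst σ)

def Realize (M : Type) (S : L.Structure M) {α : Type} (v : α → M) : Lit L α → Prop
  | eq t u => TVal M S v t = TVal M S v u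
  | neq t u => TVal M S v t ≠ TVal M S v u
  | rel R ts => RelM M S R (fun i => TVal M S v (ts i))
  | nrel R ts => ¬ RelM M S R (fun i => TVal M S v (ts i))

def syms {α : Type} (l : Lit L α) : Set (Sym L) := ⋃ t ∈ l.terms, termSyms t

end Lit

/-- A (universally closed) clause: a disjunction of literals with variables `Fin nvars`,
viewed as universally quantified. -/
structure Clause (L : FirstOrder.Language.{0, 0}) : Type where
  nvars : ℕ
  lits : List (Lit L (Fin nvars))

/-- A ground clause: a disjunction of ground literals. -/
abbrev GClause (L : FirstOrder.Language.{0, 0}) : Type := List (Lit L Empty)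

def Clause.instantiate (C : Clause L) (σ : Fin C.nvars → GTerm L) : GClause L :=
  C.lits.map (Lit.subst σ)

def Clause.syms (C : Clause L) : Set (Sym L) := ⋃ l ∈ C.lits, Lit.syms l

def GClause.syms (C : GClause L) : Set (Sym L) := ⋃ l ∈ C, Lit.syms l

def GClause.gterms (C : GClause L) : Set (GTerm L) := ⋃ l ∈ C, ⋃ t ∈ Lit.terms l, subterms t

def ClausesSyms (K : Set (Clause L)) : Set (Sym L) := ⋃ C ∈ K, C.syms

def GSyms (G : Set (GClause L)) : Set (Sym L) := ⋃ C ∈ G, GClause.syms C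

def GTerms (G : Set (GClause L)) : Set (GTerm L) := ⋃ C ∈ G, GClause.gterms C

/- ### Satisfaction -/

def ClauseHolds (M : Type) (S : L.Structure M) (C : Clause L) : Prop :=
  ∀ v : Fin C.nvars → M, ∃ l ∈ C.lits, Lit.Realize M S v l

def GClauseHolds (M : Type) (S : L.Structure M) (C : GClause L) : Prop :=
  ∃ l ∈ C, Lit.Realize M S (fun e : Empty => e.elim) l

def ModelsK (M : Type) (S : L.Structure M) (K : Set (Clause L)) : Prop :=
  ∀ C ∈ K, ClauseHolds M S C

def ModelsG (M : Type) (S : L.Structure M) (G : Set (GClause L)) : Prop :=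
  ∀ C ∈ G, GClauseHolds M S C

/-- Satisfiability (in the joint signature) of base theory `T0`, clause set `K`
and ground clauses `G`. -/
def SatTKG (T0 : L.Theory) (K : Set (Clause L)) (G : Set (GClause L)) : Prop :=
  ∃ (M : Type) (_ : Nonempty M) (S : L.Structure M),
    ModelsT M S T0 ∧ ModelsK M S K ∧ ModelsG M S G

/-- `G ⊨_{T0 ∪ K} θ` for a sentence `θ`. -/
def EntailsC (T0 : L.Theory) (K : Set (Clause L)) (G : Set (GClause L)) (θ : L.Sentence) : Prop :=
  ∀ (M : Type) (S : L.Structure M), Nonempty M →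
    ModelsT M S T0 → ModelsK M S K → ModelsG M S G → RealizeSent M S θ

/-- `A ⊨_{T0 ∪ K} θ` for sentences `A`, `θ`. -/
def EntailsS (T0 : L.Theory) (K : Set (Clause L)) (A θ : L.Sentence) : Prop :=
  ∀ (M : Type) (S : L.Structure M), Nonempty M →
    ModelsT M S T0 → ModelsK M S K → RealizeSent M S A → RealizeSent M S θ

/- ### Extension ground terms and instances -/

/-- `est(K, G)`: the ground terms starting with a function symbol in `F`
occurring in `K` or in `G`. -/
def estKG (F : Set (Sym L)) (K : Set (Clause L)) (G : Set (GClause L)) : Set (GTerm L) :=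
  { t | rootIn F t ∧
      ((∃ C ∈ K, ∃ l ∈ C.lits, ∃ s ∈ Lit.terms l, GTerm.cast t ∈ subterms s) ∨
       (∃ C ∈ G, t ∈ GClause.gterms C)) }

/-- `K[Tt]`: the set of ground instances of clauses of `K` all of whose terms starting
with a function symbol in `F` belong to `Tt`. -/
def instancesIn (F : Set (Sym L)) (K : Set (Clause L)) (Tt : Set (GTerm L)) :
    Set (GClause L) :=
  { D | ∃ C ∈ K, ∃ σ : Fin C.nvars → GTerm L, D = C.instantiate σ ∧
      ∀ t ∈ GClause.gterms (C.instantiate σ), rootIn F t → t ∈ Tt }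

/- ### Locality -/

/-- Locality of the extension of the theory `T0` together with base clauses `K0`
by the clauses `K`, with extension symbols `F`. -/
def LocalExt2 (F : Set (Sym L)) (T0 : L.Theory) (K0 K : Set (Clause L)) : Prop :=
  ∀ G : Set (GClause L), G.Finite →
    ((¬ ∃ (M : Type) (_ : Nonempty M) (S : L.Structure M),
        ModelsT M S T0 ∧ ModelsK M S K0 ∧ ModelsK M S K ∧ ModelsG M S G) ↔
     (¬ ∃ (M : Type) (_ : Nonempty M) (S : L.Structure M),
        ModelsT M S T0 ∧ ModelsK M S K0 ∧
          ModelsG M S (instancesIn F K (estKG F K G) ∪ G)))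

/-- Locality of the theory extension `T0 ⊆ T0 ∪ K` with extension symbols `F`. -/
abbrev LocalExt (F : Set (Sym L)) (T0 : L.Theory) (K : Set (Clause L)) : Prop :=
  LocalExt2 F T0 ∅ K

/-- `Ψ`-locality of the theory extension `T0 ⊆ T0 ∪ K` with extension symbols `F`. -/
def PsiLocalExt (F : Set (Sym L)) (T0 : L.Theory) (K : Set (Clause L))
    (Ψ : Set (GTerm L) → Set (GTerm L)) : Prop :=
  ∀ G : Set (GClause L), G.Finite →
    (¬ SatTKG T0 K G ↔ ¬ SatTKG T0 ∅ (instancesIn F K (Ψ (estKG F K G)) ∪ G))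

/- ### Flatness and linearity -/

/-- All symbols occurring directly below a function symbol from `F` are variables. -/
def flatTerm (F : Set (Sym L)) {α : Type} : L.Term α → Prop
  | .var _ => True
  | .func f ts =>
      ((⟨_, f⟩ : Sym L) ∈ F → ∀ i, ∃ a, ts i = Term.var a) ∧ ∀ i, flatTerm F (ts i)

/-- All symbols occurring directly below a function symbol from `F` are constants. -/
def flatGTerm (F : Set (Sym L)) : GTerm L → Prop
  | .var e => e.elim
  | .func f ts =>
      ((⟨_, f⟩ : Sym L) ∈ F → ∀ i, ∃ c : L.Functions 0, ts i = constT c) ∧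
        ∀ i, flatGTerm F (ts i)

def Clause.extTerms (F : Set (Sym L)) (C : Clause L) : Set (L.Term (Fin C.nvars)) :=
  { t | rootIn F t ∧ ∃ l ∈ C.lits, ∃ s ∈ Lit.terms l, t ∈ subterms s }

def Clause.Flat (F : Set (Sym L)) (C : Clause L) : Prop :=
  ∀ l ∈ C.lits, ∀ t ∈ Lit.terms l, flatTerm F t

def Clause.Linear (F : Set (Sym L)) (C : Clause L) : Prop :=
  (∀ t ∈ C.extTerms F, ∀ u ∈ C.extTerms F,
      (∃ x, x ∈ varOccs t ∧ x ∈ varOccs u) → t = u) ∧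
  (∀ t ∈ C.extTerms F, (varOccs t).Nodup)

/-- Every variable occurring in the clause occurs below a function symbol from `F`. -/
def Clause.VarsBelowExt (F : Set (Sym L)) (C : Clause L) : Prop :=
  ∀ x : Fin C.nvars, (∃ l ∈ C.lits, ∃ s ∈ Lit.terms l, x ∈ varOccs s) →
    ∃ t ∈ C.extTerms F, x ∈ varOccs t

def GClause.extTerms (F : Set (Sym L)) (C : GClause L) : Set (GTerm L) :=
  { t | rootIn F t ∧ t ∈ GClause.gterms C }

def GClause.Flat (F : Set (Sym L)) (C : GClause L) : Prop :=
  ∀ l ∈ C, ∀ t ∈ Lit.terms l, flatGTerm F t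

def GClause.Linear (F : Set (Sym L)) (C : GClause L) : Prop :=
  (∀ t ∈ GClause.extTerms F C, ∀ u ∈ GClause.extTerms F C,
      (∃ c, c ∈ constOccs t ∧ c ∈ constOccs u) → t = u) ∧
  (∀ t ∈ GClause.extTerms F C, (constOccs t).Nodup)

/- ### Agreement of structures and (reduct-)embeddings -/

/-- The two interpretations agree on all relation symbols and on the function symbols in `F`. -/
def AgreeOn (M : Type) (S1 S2 : L.Structure M) (F : Set (Sym L)) : Prop :=
  (∀ (n : ℕ) (f : L.Functions n), (⟨n, f⟩ : Sym L) ∈ F →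
      ∀ x : Fin n → M, FunM M S1 f x = FunM M S2 f x) ∧
  (∀ (n : ℕ) (r : L.Relations n) (x : Fin n → M), RelM M S1 r x ↔ RelM M S2 r x)

/-- An embedding of the reducts to the subsignature consisting of all predicate symbols and
the function symbols in `F`: an injective map preserving and reflecting all predicates and
preserving the functions in `F`. -/
structure SubEmb (L : FirstOrder.Language.{0, 0}) (F : Set (Sym L)) (M N : Type)
    (SM : L.Structure M) (SN : L.Structure N) : Type where
  toFun : M → N
  inj : Function.Injective toFun
  map_fun : ∀ (n : ℕ) (f : L.Functions n), (⟨n, f⟩ : Sym L) ∈ F →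
      ∀ x : Fin n → M, toFun (FunM M SM f x) = FunM N SN f (toFun ∘ x)
  map_rel : ∀ (n : ℕ) (r : L.Relations n) (x : Fin n → M),
      RelM M SM r x ↔ RelM N SN r (toFun ∘ x)

/- ### Quantifier elimination and related properties of the base theory -/

/-- `T0` allows quantifier elimination (for formulas over the symbols in `F0`). -/
def HasQE (T0 : L.Theory) (F0 : Set (Sym L)) : Prop :=
  ∀ (m : ℕ) (φ : L.Formula (Fin m)), bfSyms φ ⊆ F0 →
    ∃ ψ : L.Formula (Fin m), ψ.IsQF ∧ bfSyms ψ ⊆ F0 ∧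
      ∀ (M : Type) (S : L.Structure M), Nonempty M → ModelsT M S T0 →
        ∀ v : Fin m → M, (RealizeF M S φ v ↔ RealizeF M S ψ v)

def ModelsLits (M : Type) (S : L.Structure M) (A : List (Lit L Empty)) : Prop :=
  ∀ l ∈ A, Lit.Realize M S (fun e : Empty => e.elim) l

def litListSyms (A : List (Lit L Empty)) : Set (Sym L) := ⋃ l ∈ A, Lit.syms l

/-- Convexity of a theory (with clause axioms `K`). -/
def Convex (T0 : L.Theory) (K : Set (Clause L)) : Prop :=
  ∀ Γ : List (Lit L Empty), (∀ l ∈ Γ, l.Positive) →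
  ∀ (m : ℕ) (s t : Fin (m + 1) → GTerm L),
    (∀ (M : Type) (S : L.Structure M), Nonempty M → ModelsT M S T0 → ModelsK M S K →
        ModelsLits M S Γ → ∃ i, GVal M S (s i) = GVal M S (t i)) →
    ∃ i0, ∀ (M : Type) (S : L.Structure M), Nonempty M → ModelsT M S T0 → ModelsK M S K →
        ModelsLits M S Γ → GVal M S (s i0) = GVal M S (t i0)

/-- Stable infiniteness. -/
def StablyInfinite (T0 : L.Theory) (K : Set (Clause L)) : Prop :=
  ∀ φ : L.Sentence, φ.IsQF →
    (∃ (M : Type) (_ : Nonempty M) (S : L.Structure M),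
        ModelsT M S T0 ∧ ModelsK M S K ∧ RealizeSent M S φ) →
    ∃ (M : Type) (_ : Infinite M) (S : L.Structure M),
        ModelsT M S T0 ∧ ModelsK M S K ∧ RealizeSent M S φ

/-- Equality interpolation (for a convex theory with interpreted symbols `F0`). -/
def EqInterpolating (T0 : L.Theory) (F0 : Set (Sym L)) : Prop :=
  ∀ (A B : List (Lit L Empty)) (a b : L.Functions 0),
    (⟨0, a⟩ : Sym L) ∉ litListSyms B → (⟨0, b⟩ : Sym L) ∉ litListSyms A →
    (∀ (M : Type) (S : L.Structure M), Nonempty M → ModelsT M S T0 → ModelsLits M S A →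
        ModelsLits M S B → GVal M S (constT a) = GVal M S (constT b)) →
    ∃ t : GTerm L, termSyms t ⊆ F0 ∪ (litListSyms A ∩ litListSyms B) ∧
      ∀ (M : Type) (S : L.Structure M), Nonempty M → ModelsT M S T0 → ModelsLits M S A →
        ModelsLits M S B →
          GVal M S (constT a) = GVal M S t ∧ GVal M S t = GVal M S (constT b)

/-- A universal sentence. -/
def IsUniversalSent (s : L.Sentence) : Prop :=
  ∃ (m : ℕ) (ψ : L.BoundedFormula Empty m), ψ.IsQF ∧ s = ψ.alls

def IsUniversalTheory (T : L.Theory) : Prop := ∀ s ∈ T, IsUniversalSent s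

/-- Close the outermost `k` bound variables existentially. -/
def exsTo {m : ℕ} : ∀ {k : ℕ}, L.BoundedFormula Empty (m + k) → L.BoundedFormula Empty m
  | 0, φ => φ
  | _ + 1, φ => exsTo φ.ex

/-- A `∀∃`-sentence. -/
def IsAESent (s : L.Sentence) : Prop :=
  ∃ (m k : ℕ) (ψ : L.BoundedFormula Empty (m + k)), ψ.IsQF ∧ s = (exsTo ψ).alls

def IsAETheory (T : L.Theory) : Prop := ∀ s ∈ T, IsAESent s

/- ### General uniform interpolants and uniform interpolants (covers) -/

/-- `ψ` is a general uniform interpolant of the ground clause set `G` w.r.t. the theory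
`T0 ∪ K` and the symbols in `Keep` (which contains all interpreted symbols, the shared
uninterpreted symbols and the shared constants). -/
def IsGUIg (T0 : L.Theory) (K : Set (Clause L)) (G : Set (GClause L))
    (Keep : Set (Sym L)) (ψ : L.Sentence) : Prop :=
  ψ.IsQF ∧ sentSyms ψ ⊆ Keep ∧ EntailsC T0 K G ψ ∧
  ∀ θ : L.Sentence, θ.IsQF → sentSyms θ ∩ GSyms G ⊆ Keep →
    EntailsC T0 K G θ → EntailsS T0 K ψ θ

/-- `ψ` is a general uniform interpolant of the ground formula `φ` w.r.t. the theory
`T0 ∪ K` and the symbols in `Keep`. -/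
def IsGUIs (T0 : L.Theory) (K : Set (Clause L)) (φ : L.Sentence)
    (Keep : Set (Sym L)) (ψ : L.Sentence) : Prop :=
  ψ.IsQF ∧ sentSyms ψ ⊆ Keep ∧ EntailsS T0 K φ ψ ∧
  ∀ θ : L.Sentence, θ.IsQF → sentSyms θ ∩ sentSyms φ ⊆ Keep →
    EntailsS T0 K φ θ → EntailsS T0 K ψ θ

/-- `ψ` is a uniform interpolant (cover) of `Γ` w.r.t. the theory `T0 ∪ K`, the set `CC`
of (eliminable) constants and the kept constants `Cs ⊆ CC`; all other symbols are treated
as interpreted. -/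
def IsUI (T0 : L.Theory) (K : Set (Clause L)) (CC Cs : Set (Sym L)) (Γ ψ : L.Sentence) : Prop :=
  ψ.IsQF ∧ sentSyms ψ ∩ CC ⊆ Cs ∧ EntailsS T0 K Γ ψ ∧
  ∀ θ : L.Sentence, θ.IsQF → sentSyms θ ∩ sentSyms Γ ∩ CC ⊆ Cs →
    EntailsS T0 K Γ θ → EntailsS T0 K ψ θ

/- ### The semantic specification of Algorithm 1 -/

/-- The constants occurring in some term of `S` as an argument of a function symbol in `Sigs`. -/
def argConstsOf (Sigs : Set (Sym L)) (S : Set (GTerm L)) : Set (Sym L) :=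
  { p | ∃ c : L.Functions 0, p = ⟨0, c⟩ ∧
      ∃ t ∈ S, ∃ (n : ℕ) (f : L.Functions n) (ts : Fin n → GTerm L),
        t = Term.func f ts ∧ (⟨n, f⟩ : Sym L) ∈ Sigs ∧ ∃ i, ts i = constT c }

/-- Semantic specification of the output `Γ` of Algorithm 1, applied to the theory extension
`T0 ∪ K` (extension symbols `F`), the ground clauses `G` and the instantiation terms `Tt`,
keeping exactly the symbols in `Keep` (all interpreted symbols, the parameters `Sigs` and the
non-eliminated constants):  `Γ` is a ground formula over `Keep` which, on each model of `T0`,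
expresses the existence of values for the eliminated constants and for the purified names of
the extension terms (equivalently, of a reinterpretation of the eliminated symbols) satisfying
`K[Tt] ∪ G`. -/
def AlgOneOutput (F : Set (Sym L)) (T0 : L.Theory) (K : Set (Clause L)) (G : Set (GClause L))
    (Tt : Set (GTerm L)) (Keep : Set (Sym L)) (Γ : L.Sentence) : Prop :=
  Γ.IsQF ∧ sentSyms Γ ⊆ Keep ∧
  ∀ (M : Type) (S : L.Structure M), Nonempty M → ModelsT M S T0 →
    (RealizeSent M S Γ ↔
      ∃ S' : L.Structure M, AgreeOn M S S' Keep ∧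
        ModelsG M S' (instancesIn F K Tt) ∧ ModelsG M S' G)

/- ### Implicit definability -/

/-- `f` is implicitly definable w.r.t. `T0 ∪ K` over the symbols in `Pi1`:
any two interpretations (on the same universe) which agree on `Pi1` and are both models
of `T0 ∪ K` interpret `f` in the same way.  (This is the standard semantic rendering of
the definition via renaming the symbols outside `Pi1` to primed copies.) -/
def ImplicitlyDefinable (T0 : L.Theory) (K : Set (Clause L)) (Pi1 : Set (Sym L))
    {n : ℕ} (f : L.Functions n) : Prop :=
  ∀ (M : Type), Nonempty M → ∀ S1 S2 : L.Structure M,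
    AgreeOn M S1 S2 Pi1 →
    ModelsT M S1 T0 → ModelsK M S1 K → ModelsT M S2 T0 → ModelsK M S2 K →
    ∀ x : Fin n → M, FunM M S1 f x = FunM M S2 f x

end PaperSE

namespace PaperSE

/-- The closure operator `Ψ` used for chains `T0 ⊆ T0 ∪ UIF_{Σf} ⊆ T0 ∪ UIF_{Σf} ∪ K`:
whenever `f(t₁,…,tₙ) ∈ T` with `f ∈ Σd`, then `g(t'₁,…,t'ₖ) ∈ Ψ(T)` for every
`g ∈ Σf ∪ Σd` of arity `k` and all `t'ⱼ ∈ {t₁,…,tₙ}`. -/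
def psiDef {L : FirstOrder.Language.{0, 0}} (Sigf Sigd : Set (Sym L))
    (Tset : Set (GTerm L)) : Set (GTerm L) :=
  Tset ∪
    { s | ∃ t ∈ Tset, ∃ (n : ℕ) (f : L.Functions n) (ts : Fin n → GTerm L),
        t = Term.func f ts ∧ (⟨n, f⟩ : Sym L) ∈ Sigd ∧
        ∃ (k : ℕ) (g : L.Functions k) (sel : Fin k → Fin n),
          (⟨k, g⟩ : Sym L) ∈ Sigf ∪ Sigd ∧ s = Term.func g (fun j => ts (sel j)) }

/-! ### Compactness and joint consistency -/

/-- Compactness for sets of formulas with free variables. -/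
theorem exists_realize_of_finset_realize {L : FirstOrder.Language.{0, 0}} {α : Type}
    (Φ : Set (L.Formula α))
    (h : ∀ Δ : Finset (L.Formula α), (Δ : Set (L.Formula α)) ⊆ Φ →
      ∃ (M : Type) (_ : Nonempty M) (_ : L.Structure M) (v : α → M), ∀ φ ∈ Δ, φ.Realize v) :
    ∃ (M : Type) (_ : Nonempty M) (_ : L.Structure M) (v : α → M), ∀ φ ∈ Φ, φ.Realize v := by
  classical
  have hsat : Theory.IsSatisfiable (Formula.equivSentence '' Φ : L[[α]].Theory) := by
    rw [Theory.isSatisfiable_iff_isFinitelySatisfiable]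
    intro Θ hΘ
    obtain ⟨Δ, hΔ, rfl⟩ := Finset.subset_set_image_iff.1 hΘ
    obtain ⟨M, hM, S, v, hv⟩ := h Δ hΔ
    let := constantsOn.structure v
    have : M ⊨ (((Δ.image Formula.equivSentence : Finset L[[α]].Sentence)) : L[[α]].Theory) := by
      refine ⟨fun φ hφ => ?_⟩
      obtain ⟨ψ, hψ, rfl⟩ := Finset.mem_image.1 (Finset.mem_coe.1 hφ)
      exact (Formula.realize_equivSentence M ψ).2 (hv ψ hψ)
    exact Theory.Model.isSatisfiable M
  obtain ⟨N⟩ := hsat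
  let : L.Structure N := (L.lhomWithConstants α).reduct N
  have : (L.lhomWithConstants α).IsExpansionOn N := LHom.isExpansionOn_reduct _ _
  refine ⟨N, inferInstance, inferInstance, fun a => (L.con a : N), fun φ hφ => ?_⟩
  rw [← Formula.realize_equivSentence]
  exact Theory.realize_sentence_of_mem (Formula.equivSentence '' Φ : L[[α]].Theory)
    ⟨φ, hφ, rfl⟩

/-- Two tuples satisfy the same formulas of the language `L0`, mapped into `L` by `ι`. -/
def SameType {L0 L : FirstOrder.Language.{0, 0}} (ι : L0 →ᴸ L) {A B I : Type}
    [L.Structure A] [L.Structure B] (s : I → A) (t : I → B) : Prop :=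
  ∀ φ : L0.Formula I, (ι.onFormula φ).Realize s ↔ (ι.onFormula φ).Realize t

section Joint

variable {L0 L : FirstOrder.Language.{0, 0}} {ι : L0 →ᴸ L}

theorem onFormula_relabel {α β : Type} (g : α → β) (φ : L0.Formula α)
    {M : Type} [L.Structure M] (v : β → M) :
    (ι.onFormula (φ.relabel g)).Realize v ↔ (ι.onFormula φ).Realize (v ∘ g) := by
  let := ι.reduct M
  have : ι.IsExpansionOn M := LHom.isExpansionOn_reduct _ _
  rw [LHom.realize_onFormula, LHom.realize_onFormula, Formula.realize_relabel]

theorem onFormula_iExs {α β : Type} [Finite β] (φ : L0.Formula (α ⊕ β))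
    {M : Type} [L.Structure M] (v : α → M) :
    (ι.onFormula (φ.iExs β)).Realize v ↔ ∃ w : β → M, (ι.onFormula φ).Realize (Sum.elim v w) := by
  let := ι.reduct M
  have : ι.IsExpansionOn M := LHom.isExpansionOn_reduct _ _
  simp only [LHom.realize_onFormula, Formula.realize_iExs]

theorem SameType.symm {A B I : Type} [L.Structure A] [L.Structure B] {s : I → A} {t : I → B}
    (h : SameType ι s t) : SameType ι t s := fun φ => (h φ).symm

theorem SameType.eq_iff {A B I : Type} [L.Structure A] [L.Structure B] {s : I → A} {t : I → B}
    (h : SameType ι s t) (i j : I) : s i = s j ↔ t i = t j := by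
  have key := h (Term.equal (Term.var i) (Term.var j))
  let := ι.reduct A
  let := ι.reduct B
  have : ι.IsExpansionOn A := LHom.isExpansionOn_reduct _ _
  have : ι.IsExpansionOn B := LHom.isExpansionOn_reduct _ _
  simpa [LHom.realize_onFormula, Formula.realize_equal] using key

theorem SameType.injective {A B : Type} [L.Structure A] [L.Structure B] {j : A → B}
    (h : SameType ι id j) : Function.Injective j :=
  fun x y hxy => (h.eq_iff x y).2 hxy

theorem SameType.map_fun {A B : Type} [L.Structure A] [L.Structure B] {j : A → B}
    (h : SameType ι id j) {n : ℕ} (f : L0.Functions n) (x : Fin n → A) :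
    j (Structure.funMap (ι.onFunction f) x) = Structure.funMap (ι.onFunction f) (j ∘ x) := by
  have key := h (Term.equal (Term.var (Structure.funMap (ι.onFunction f) x))
    (Term.func f fun i => Term.var (x i)))
  let := ι.reduct A
  let := ι.reduct B
  have : ι.IsExpansionOn A := LHom.isExpansionOn_reduct _ _
  have : ι.IsExpansionOn B := LHom.isExpansionOn_reduct _ _
  rw [LHom.realize_onFormula, LHom.realize_onFormula, Formula.realize_equal,
    Formula.realize_equal] at key
  exact key.1 rfl

theorem SameType.map_rel {A B : Type} [L.Structure A] [L.Structure B] {j : A → B}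
    (h : SameType ι id j) {n : ℕ} (r : L0.Relations n) (x : Fin n → A) :
    Structure.RelMap (ι.onRelation r) (j ∘ x) ↔ Structure.RelMap (ι.onRelation r) x := by
  have key := h (r.formula fun i => Term.var (x i))
  let := ι.reduct A
  let := ι.reduct B
  have : ι.IsExpansionOn A := LHom.isExpansionOn_reduct _ _
  have : ι.IsExpansionOn B := LHom.isExpansionOn_reduct _ _
  rw [LHom.realize_onFormula, LHom.realize_onFormula, Formula.realize_rel,
    Formula.realize_rel] at key
  exact key.symm

/-- A formula depends on finitely many free variables. -/
theorem exists_finset_realize_congr {α : Type} (φ : L.Formula α) :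
    ∃ s : Finset α, ∀ (M : Type) [L.Structure M] (v w : α → M), (∀ a ∈ s, v a = w a) →
      (φ.Realize v ↔ φ.Realize w) := by
  classical
  refine ⟨φ.freeVarFinset, fun M _ v w h => ?_⟩
  have h1 := BoundedFormula.realize_restrictFreeVar (M := M) (φ := φ) (f := fun a => a)
    (v := fun a : φ.freeVarFinset => v a) (xs := default) v (fun _ => rfl)
  have h2 := BoundedFormula.realize_restrictFreeVar (M := M) (φ := φ) (f := fun a => a)
    (v := fun a : φ.freeVarFinset => v a) (xs := default) w (fun a => h a a.2)
  exact h1.symm.trans h2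

/-- If `s` and `t` have the same type then any formula true in the target structure can be
satisfied in the source structure, with the values of `t` replaced by those of `s`. -/
theorem SameType.exists_realize {A B I : Type} [L.Structure A] [L.Structure B] [Nonempty B]
    {s : I → A} {t : I → B} (h : SameType ι s t) (ψ : L0.Formula B)
    (hψ : (ι.onFormula ψ).Realize (id : B → B)) :
    ∃ v : B → A, (∀ i, v (t i) = s i) ∧ (ι.onFormula ψ).Realize v := by
  classical
  obtain ⟨fv, hfv⟩ := exists_finset_realize_congr (ι.onFormula ψ)
  obtain ⟨b0⟩ := ‹Nonempty B›
  let β := {b // b ∈ insert b0 fv}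
  let g : B → I ⊕ β := fun b =>
    if hb : ∃ i, t i = b then Sum.inl hb.choose
    else if hb' : b ∈ insert b0 fv then Sum.inr ⟨b, hb'⟩
    else Sum.inr ⟨b0, Finset.mem_insert_self _ _⟩
  have hB : (ι.onFormula ((ψ.relabel g).iExs β)).Realize t := by
    rw [onFormula_iExs]
    refine ⟨Subtype.val, ?_⟩
    rw [onFormula_relabel]
    refine (hfv B _ _ fun b hb => ?_).1 hψ
    simp only [id, Function.comp_apply, g]
    split_ifs with h1 h2
    · exact h1.choose_spec.symm
    · rfl
    · exact absurd (Finset.mem_insert_of_mem hb) h2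
  obtain ⟨w, hw⟩ := (onFormula_iExs _ _).1 ((h _).2 hB)
  rw [onFormula_relabel] at hw
  refine ⟨_, fun i => ?_, hw⟩
  have hi : ∃ k, t k = t i := ⟨i, rfl⟩
  simp only [Function.comp_apply, g, dif_pos hi, Sum.elim_inl]
  exact (h.eq_iff _ _).2 hi.choose_spec

theorem realize_toFinset_inf_onFormula {α M : Type} [L.Structure M] (l : List (L0.Formula α))
    (v : α → M) :
    (ι.onFormula (l.foldr (· ⊓ ·) ⊤)).Realize v ↔ ∀ ψ ∈ l, (ι.onFormula ψ).Realize v := by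
  let := ι.reduct M
  have : ι.IsExpansionOn M := LHom.isExpansionOn_reduct _ _
  simp only [LHom.realize_onFormula]
  exact BoundedFormula.realize_foldr_inf l v default

/-- Amalgamation of a structure with an `L0`-elementarily equivalent one, over a common tuple,
in an `L`-elementary extension of the first structure. -/
theorem SameType.exists_amalgam {A B I : Type} [L.Structure A] [L.Structure B] [Nonempty A]
    [Nonempty B] {s : I → A} {t : I → B} (h : SameType ι s t) :
    ∃ (C : Type) (_ : Nonempty C) (_ : L.Structure C) (e : A ↪ₑ[L] C) (k : B → C),
      SameType ι id k ∧ ∀ i, k (t i) = e (s i) := by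
  classical
  let Φ1 : Set (L.Formula (A ⊕ B)) :=
    {χ | ∃ φ : L.Formula A, φ.Realize (id : A → A) ∧ χ = φ.relabel Sum.inl}
  let Φ2 : Set (L.Formula (A ⊕ B)) :=
    {χ | ∃ ψ : L0.Formula B, (ι.onFormula ψ).Realize (id : B → B) ∧
      χ = ι.onFormula (ψ.relabel Sum.inr)}
  let Φ3 : Set (L.Formula (A ⊕ B)) :=
    {χ | ∃ i, χ = Term.equal (Term.var (Sum.inr (t i))) (Term.var (Sum.inl (s i)))}
  obtain ⟨C, hC, SC, v, hv⟩ := exists_realize_of_finset_realize (Φ1 ∪ Φ2 ∪ Φ3) (by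
    intro Δ hΔ
    have key : ∃ l : List (L0.Formula B), (∀ ψ ∈ l, (ι.onFormula ψ).Realize (id : B → B)) ∧
        ∀ χ ∈ Δ, χ ∈ Φ2 → ∃ ψ ∈ l, χ = ι.onFormula (ψ.relabel Sum.inr) := by
      clear hΔ
      induction Δ using Finset.induction_on with
      | empty => exact ⟨[], by simp, by simp⟩
      | insert χ Δ _ ih =>
        obtain ⟨l, hl, hl'⟩ := ih
        by_cases hχ : χ ∈ Φ2
        · obtain ⟨ψ, hψ, rfl⟩ := hχ
          refine ⟨ψ :: l, ?_, ?_⟩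
          · simpa using ⟨hψ, hl⟩
          · intro χ' h1 h2
            rcases Finset.mem_insert.1 h1 with rfl | h1
            · exact ⟨ψ, by simp, rfl⟩
            · obtain ⟨ψ', h3, h4⟩ := hl' χ' h1 h2
              exact ⟨ψ', by simp [h3], h4⟩
        · refine ⟨l, hl, fun χ' h1 h2 => ?_⟩
          rcases Finset.mem_insert.1 h1 with rfl | h1
          · exact absurd h2 hχ
          · exact hl' χ' h1 h2
    obtain ⟨l, hl, hl'⟩ := key
    obtain ⟨v, hvt, hv⟩ := h.exists_realize _ ((realize_toFinset_inf_onFormula l id).2 hl)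
    rw [realize_toFinset_inf_onFormula] at hv
    refine ⟨A, inferInstance, inferInstance, Sum.elim id v, fun χ hχ => ?_⟩
    rcases hΔ hχ with (⟨φ, hφ, rfl⟩ | h2) | ⟨i, rfl⟩
    · rw [Formula.realize_relabel]; exact hφ
    · obtain ⟨ψ, hψ, rfl⟩ := hl' χ hχ h2
      rw [onFormula_relabel]; exact hv ψ hψ
    · rw [Formula.realize_equal]; exact hvt i)
  have he : ∀ φ : L.Formula A, φ.Realize (id : A → A) → φ.Realize (v ∘ Sum.inl) := fun φ hφ =>
    Formula.realize_relabel.1 (hv _ (Or.inl (Or.inl ⟨φ, hφ, rfl⟩)))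
  have hk : ∀ ψ : L0.Formula B, (ι.onFormula ψ).Realize (id : B → B) →
      (ι.onFormula ψ).Realize (v ∘ Sum.inr) := fun ψ hψ =>
    (onFormula_relabel _ _ _).1 (hv _ (Or.inl (Or.inr ⟨ψ, hψ, rfl⟩)))
  refine ⟨C, hC, SC, ⟨v ∘ Sum.inl, fun n φ x => ?_⟩, v ∘ Sum.inr, fun ψ => ⟨hk ψ, fun hψ => ?_⟩,
    fun i => ?_⟩
  · have h1 := he (φ.relabel x)
    have h2 := he (φ.relabel x).not
    rw [Formula.realize_not, Formula.realize_not] at h2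
    simp only [Formula.realize_relabel, Function.id_comp] at h1 h2
    exact ⟨fun h3 => by_contra fun h4 => h2 h4 h3, h1⟩
  · by_contra h1
    exact (hk ψ.not h1) hψ
  · exact Formula.realize_equal.1 (hv _ (Or.inr ⟨i, rfl⟩))

/-- The colimit of a sequence of injections. -/
theorem exists_colimit (X : ℕ → Type) (i : ∀ n, X n → X (n + 1))
    (hi : ∀ n, Function.Injective (i n)) :
    ∃ (Y : Type) (c : ∀ n, X n → Y), (∀ n x, c (n + 1) (i n x) = c n x) ∧
      (∀ n, Function.Injective (c n)) ∧ ∀ y, ∃ n x, c n x = y := by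
  let p : ∀ n m, n ≤ m → X n → X m := fun n m h => Nat.leRecOn h (fun {k} => i k)
  have ptrans : ∀ n m k (h1 : n ≤ m) (h2 : m ≤ k) x, p m k h2 (p n m h1 x) = p n k (h1.trans h2) x :=
    fun n m k h1 h2 x => (Nat.leRecOn_trans h1 h2 x).symm
  have pinj : ∀ n m h, Function.Injective (p n m h) := fun n m h =>
    Nat.leRecOn_injective h _ hi
  let r : Setoid (Σ n, X n) :=
    { r := fun a b => ∃ k h1 h2, p a.1 k h1 a.2 = p b.1 k h2 b.2
      iseqv :=
        { refl := fun a => ⟨a.1, le_rfl, le_rfl, rfl⟩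
          symm := fun ⟨k, h1, h2, h⟩ => ⟨k, h2, h1, h.symm⟩
          trans := by
            rintro a b d ⟨k, h1, h2, h⟩ ⟨k', h1', h2', h'⟩
            refine ⟨max k k', h1.trans (le_max_left _ _), h2'.trans (le_max_right _ _), ?_⟩
            rw [← ptrans _ _ _ h1 (le_max_left _ _), h, ptrans,
              ← ptrans _ _ _ h2' (le_max_right _ _), ← h', ptrans] } }
  refine ⟨Quotient r, fun n x => Quotient.mk r ⟨n, x⟩, fun n x => ?_, fun n x y hxy => ?_,
    fun y => ?_⟩
  · refine Quotient.sound ⟨n + 1, le_rfl, Nat.le_succ n, ?_⟩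
    change p (n + 1) (n + 1) le_rfl (i n x) = p n (n + 1) (Nat.le_succ n) x
    simp only [p]
    rw [Nat.leRecOn_self, Nat.leRecOn_succ']
  · obtain ⟨k, h1, h2, h⟩ := Quotient.exact hxy
    exact pinj _ _ _ h
  · obtain ⟨⟨n, x⟩, rfl⟩ := Quotient.exists_rep y
    exact ⟨n, x, rfl⟩

/-- The union of an elementary chain (Tarski–Vaught). -/
theorem exists_structure_of_elementary_chain (Z : ℕ → Type) [∀ k, L.Structure (Z k)]
    (i : ∀ k, Z k ↪ₑ[L] Z (k + 1)) {Y : Type} (c : ∀ k, Z k → Y)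
    (hc : ∀ k x, c (k + 1) (i k x) = c k x) (hinj : ∀ k, Function.Injective (c k))
    (hsurj : ∀ y, ∃ k x, c k x = y) :
    ∃ _ : L.Structure Y, ∀ k, ∃ e : Z k ↪ₑ[L] Y, ∀ x, e x = c k x := by
  classical
  have hmono : ∀ k m, k ≤ m → ∃ g : Z k ↪ₑ[L] Z m, ∀ x, c m (g x) = c k x := by
    intro k m h
    induction h with
    | refl => exact ⟨ElementaryEmbedding.refl L _, fun x => rfl⟩
    | step _ ih =>
      obtain ⟨g, hg⟩ := ih
      exact ⟨(i _).comp g, fun x => by rw [ElementaryEmbedding.comp_apply, hc, hg]⟩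
  have hlift1 : ∀ k y, ∃ m, k ≤ m ∧ ∃ x, c m x = y := by
    intro k y
    obtain ⟨m, x, rfl⟩ := hsurj y
    obtain ⟨g, hg⟩ := hmono m (max k m) (le_max_right _ _)
    exact ⟨_, le_max_left k m, g x, hg x⟩
  have hlift : ∀ {n : ℕ} (v : Fin n → Y), ∃ (k : ℕ) (w : Fin n → Z k), c k ∘ w = v := by
    intro n v
    choose k w hw using fun j => hsurj (v j)
    have hk : ∀ j, k j ≤ Finset.univ.sup k := fun j => Finset.le_sup (Finset.mem_univ j)
    choose g hg using fun j => hmono (k j) _ (hk j)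
    exact ⟨_, fun j => g j (w j), funext fun j => by simp [hg, hw]⟩
  choose K W hKW using fun n => @hlift n
  have hcommon : ∀ {n : ℕ} {k m : ℕ} (v : Fin n → Z k) (w : Fin n → Z m), c k ∘ v = c m ∘ w →
      ∃ (l : ℕ) (g : Z k ↪ₑ[L] Z l) (g' : Z m ↪ₑ[L] Z l), (∀ x, c l (g x) = c k x) ∧
        (∀ x, c l (g' x) = c m x) ∧ g ∘ v = g' ∘ w := by
    intro n k m v w h
    obtain ⟨g, hg⟩ := hmono k (max k m) (le_max_left _ _)
    obtain ⟨g', hg'⟩ := hmono m (max k m) (le_max_right _ _)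
    refine ⟨_, g, g', hg, hg', funext fun j => hinj _ ?_⟩
    simp only [Function.comp_apply, hg, hg']
    exact congrFun h j
  let S : L.Structure Y :=
    { funMap := fun {n} f v => c (K n v) (Structure.funMap f (W n v))
      RelMap := fun {n} r v => Structure.RelMap r (W n v) }
  have hfun : ∀ {n : ℕ} (f : L.Functions n) k (w : Fin n → Z k),
      Structure.funMap f (c k ∘ w) = c k (Structure.funMap f w) := by
    intro n f k w
    obtain ⟨l, g, g', hg, hg', hgg⟩ := hcommon _ _ (hKW n (c k ∘ w))
    change c _ (Structure.funMap f (W n (c k ∘ w))) = _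
    rw [← hg, ← hg', g.map_fun, g'.map_fun, hgg]
  have hrel : ∀ {n : ℕ} (r : L.Relations n) k (w : Fin n → Z k),
      Structure.RelMap r (c k ∘ w) ↔ Structure.RelMap r w := by
    intro n r k w
    obtain ⟨l, g, g', hg, hg', hgg⟩ := hcommon _ _ (hKW n (c k ∘ w))
    change Structure.RelMap r (W n (c k ∘ w)) ↔ _
    rw [← g.map_rel, ← g'.map_rel, hgg]
  have hterm : ∀ {α : Type} (t : L.Term α) k (v : α → Z k),
      t.realize (c k ∘ v) = c k (t.realize v) := by
    intro α t k v
    induction t with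
    | var a => rfl
    | func f ts ih =>
      simp only [Term.realize_func, ih]
      exact hfun f k _
  have hform : ∀ {α : Type} {n : ℕ} (φ : L.BoundedFormula α n) k (v : α → Z k) (xs : Fin n → Z k),
      φ.Realize (c k ∘ v) (c k ∘ xs) ↔ φ.Realize v xs := by
    intro α n φ
    induction φ with
    | falsum => intro k v xs; rfl
    | equal t u =>
      intro k v xs
      simp only [BoundedFormula.Realize, ← Sum.comp_elim, hterm]
      exact (hinj k).eq_iff
    | rel r ts =>
      intro k v xs
      simp only [BoundedFormula.Realize, ← Sum.comp_elim, hterm]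
      exact hrel r k _
    | imp φ ψ ih1 ih2 =>
      intro k v xs
      simp only [BoundedFormula.realize_imp, ih1, ih2]
    | all φ ih =>
      intro k v xs
      simp only [BoundedFormula.realize_all]
      constructor
      · intro h x
        rw [← ih, Fin.comp_snoc]
        exact h _
      · intro h y
        obtain ⟨m, hkm, x, rfl⟩ := hlift1 k y
        obtain ⟨g, hg⟩ := hmono k m hkm
        have h' : (φ.all).Realize (g ∘ v) (g ∘ xs) :=
          (g.map_boundedFormula φ.all v xs).2 (BoundedFormula.realize_all.2 h)
        have h2 := (ih m _ _).2 (BoundedFormula.realize_all.1 h' x)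
        rw [Fin.comp_snoc] at h2
        have e : c m ∘ g = c k := funext hg
        rwa [← Function.comp_assoc, ← Function.comp_assoc, e] at h2
  refine ⟨S, fun k => ⟨⟨c k, fun n φ x => ?_⟩, fun x => rfl⟩⟩
  have := hform φ k x default
  rwa [Unique.eq_default (c k ∘ default)] at this

/-- One link of the alternating chain used for joint consistency. -/
structure Link (ι : L0 →ᴸ L) where
  A : Type
  B : Type
  neA : Nonempty A
  neB : Nonempty B
  strA : L.Structure A
  strB : L.Structure B
  j : A → B
  hj : SameType ι id j

attribute [instance] Link.neA Link.neB Link.strA Link.strB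

theorem Link.exists_next (P : Link ι) :
    ∃ (C : Type) (_ : Nonempty C) (_ : L.Structure C) (e : P.A ↪ₑ[L] C)
      (k : P.B → C), SameType ι id k ∧ ∀ a, k (P.j a) = e a :=
  P.hj.exists_amalgam

/-- The next link: its source is the old target, its target elementarily extends the old source. -/
noncomputable def Link.next (P : Link ι) : Link ι where
  A := P.B
  B := P.exists_next.choose
  neA := P.neB
  neB := P.exists_next.choose_spec.choose
  strA := P.strB
  strB := P.exists_next.choose_spec.choose_spec.choose
  j := P.exists_next.choose_spec.choose_spec.choose_spec.choose_spec.choose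
  hj := P.exists_next.choose_spec.choose_spec.choose_spec.choose_spec.choose_spec.1

theorem Link.exists_elementary (P : Link ι) :
    ∃ e : P.A ↪ₑ[L] P.next.B, ∀ a, P.next.j (P.j a) = e a :=
  ⟨P.exists_next.choose_spec.choose_spec.choose_spec.choose,
    P.exists_next.choose_spec.choose_spec.choose_spec.choose_spec.choose_spec.2⟩

/-- The alternating chain starting from a given link. -/
noncomputable def Link.chain (P : Link ι) : ℕ → Link ι
  | 0 => P
  | n + 1 => (Link.chain P n).next

/-- Robinson joint consistency: two structures with tuples of the same `L0`-type have
`L`-elementary extensions on a common universe whose `L0`-reducts coincide and in which the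
tuples coincide. -/
theorem SameType.exists_joint {A B I : Type} [L.Structure A] [L.Structure B] [Nonempty A]
    [Nonempty B] {s : I → A} {t : I → B} (h : SameType ι s t) :
    ∃ (Y : Type) (S1 S2 : L.Structure Y)
      (e1 : A → Y) (e2 : B → Y),
      (letI := S1; ∃ e : A ↪ₑ[L] Y, ∀ x, e x = e1 x) ∧
      (letI := S2; ∃ e : B ↪ₑ[L] Y, ∀ x, e x = e2 x) ∧ (∀ i, e1 (s i) = e2 (t i)) ∧
      (∀ n (f : L0.Functions n) (x : Fin n → Y),
        S1.funMap (ι.onFunction f) x = S2.funMap (ι.onFunction f) x) ∧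
      (∀ n (r : L0.Relations n) (x : Fin n → Y),
        S1.RelMap (ι.onRelation r) x ↔ S2.RelMap (ι.onRelation r) x) := by
  obtain ⟨C, hC, SC, e, k, hk, hke⟩ := h.exists_amalgam
  let P := Link.chain (ι := ι) ⟨B, C, inferInstance, hC, inferInstance, SC, k, hk⟩
  let j : ∀ n, (P n).A → (P (n + 1)).A := fun n => (P n).j
  have hj : ∀ n, SameType ι id (j n) := fun n => (P n).hj
  have he : ∀ n, ∃ e : (P n).A ↪ₑ[L] (P (n + 2)).A, ∀ a, j (n + 1) (j n a) = e a :=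
    fun n => (P n).exists_elementary
  choose E hE using he
  obtain ⟨Y, c, hc, hinj, hsurj⟩ := exists_colimit (fun n => (P n).A) j fun n => (hj n).injective
  have hc2 : ∀ n x, c (n + 2) (E n x) = c n x := fun n x => by
    rw [← hE, hc, hc]
  have hpar : ∀ y, (∃ k x, c (2 * k) x = y) ∧ ∃ k x, c (2 * k + 1) x = y := by
    intro y
    obtain ⟨n, x, rfl⟩ := hsurj y
    obtain ⟨m, rfl | rfl⟩ := Nat.even_or_odd' n
    · exact ⟨⟨m, x, rfl⟩, ⟨m, j (2 * m) x, hc (2 * m) x⟩⟩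
    · exact ⟨⟨m + 1, j (2 * m + 1) x, hc (2 * m + 1) x⟩, ⟨m, x, rfl⟩⟩
  obtain ⟨S2, hS2⟩ := exists_structure_of_elementary_chain (fun k => (P (2 * k)).A)
    (fun k => E (2 * k)) (fun k => c (2 * k)) (fun k => hc2 (2 * k)) (fun k => hinj _)
    fun y => (hpar y).1
  obtain ⟨S1, hS1⟩ := exists_structure_of_elementary_chain (fun k => (P (2 * k + 1)).A)
    (fun k => E (2 * k + 1)) (fun k => c (2 * k + 1)) (fun k => hc2 (2 * k + 1)) (fun k => hinj _)
    fun y => (hpar y).2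
  have hlift : ∀ {n : ℕ} (v : Fin n → Y), ∃ (k : ℕ) (w : Fin n → (P (2 * k)).A),
      c (2 * k) ∘ w = v := by
    have hup : ∀ k m, k ≤ m → ∀ x, ∃ x', c (2 * m) x' = c (2 * k) x := by
      intro k m hkm x
      induction hkm with
      | refl => exact ⟨x, rfl⟩
      | step _ ih =>
        obtain ⟨x', hx'⟩ := ih
        exact ⟨E _ x', (hc2 _ _).trans hx'⟩
    intro n v
    choose k w hw using fun i => (hpar (v i)).1
    choose w' hw' using fun i =>
      hup (k i) (Finset.univ.sup k) (Finset.le_sup (Finset.mem_univ i)) (w i)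
    exact ⟨_, w', funext fun i => (hw' i).trans (hw i)⟩
  refine ⟨Y, S1, S2, fun a => c 1 (e a), c 0, ?_, hS2 0, fun i => ?_, fun n f x => ?_,
    fun n r x => ?_⟩
  · obtain ⟨e', he'⟩ := hS1 0
    exact ⟨@ElementaryEmbedding.comp L A C Y _ SC S1 e' e, fun x => he' _⟩
  · change c 1 (e (s i)) = c 0 (t i)
    rw [← hke]
    exact hc 0 (t i)
  · obtain ⟨k, w, rfl⟩ := hlift x
    obtain ⟨e2, he2⟩ := hS2 k
    obtain ⟨e1, he1⟩ := hS1 k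
    have h2 := @ElementaryEmbedding.map_fun L _ Y _ S2 e2 n (ι.onFunction f) w
    have h1 := @ElementaryEmbedding.map_fun L _ Y _ S1 e1 n (ι.onFunction f) (j _ ∘ w)
    have h3 := (hj (2 * k)).map_fun f w
    rw [← h3] at h1
    have a1 : (e1 ∘ j (2 * k) ∘ w : Fin n → Y) = c (2 * k) ∘ w :=
      funext fun i => (he1 _).trans (hc _ _)
    have a2 : (e2 ∘ w : Fin n → Y) = c (2 * k) ∘ w := funext fun i => he2 _
    rw [a1, he1, hc] at h1
    rw [a2, he2] at h2
    exact h1.symm.trans h2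
  · obtain ⟨k, w, rfl⟩ := hlift x
    obtain ⟨e2, he2⟩ := hS2 k
    obtain ⟨e1, he1⟩ := hS1 k
    have h2 := @ElementaryEmbedding.map_rel L _ Y _ S2 e2 n (ι.onRelation r) w
    have h1 := @ElementaryEmbedding.map_rel L _ Y _ S1 e1 n (ι.onRelation r) (j _ ∘ w)
    have h3 := (hj (2 * k)).map_rel r w
    have a1 : (e1 ∘ j (2 * k) ∘ w : Fin n → Y) = c (2 * k) ∘ w :=
      funext fun i => (he1 _).trans (hc _ _)
    have a2 : (e2 ∘ w : Fin n → Y) = c (2 * k) ∘ w := funext fun i => he2 _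
    rw [a1] at h1
    rw [a2] at h2
    exact h1.trans (h3.trans h2.symm)

end Joint

theorem AgreeOn.mono {L : FirstOrder.Language.{0, 0}} {M : Type} {S1 S2 : L.Structure M}
    {F F' : Set (Sym L)} (h : AgreeOn M S1 S2 F) (hF : F' ⊆ F) : AgreeOn M S1 S2 F' :=
  ⟨fun n f hf x => h.1 n f (hF hf) x, h.2⟩

theorem AgreeOn.tVal_eq {L : FirstOrder.Language.{0, 0}} {M : Type} {S1 S2 : L.Structure M}
    {F : Set (Sym L)} (h : AgreeOn M S1 S2 F) {α : Type} (v : α → M) (t : L.Term α)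
    (ht : termSyms t ⊆ F) : TVal M S1 v t = TVal M S2 v t := by
  induction t with
  | var a => rfl
  | func f ts ih =>
    have hi : ∀ i, TVal M S1 v (ts i) = TVal M S2 v (ts i) := fun i =>
      ih i (((Set.subset_iUnion (fun i => termSyms (ts i)) i).trans
        (Set.subset_insert _ _)).trans ht)
    have hf := h.1 _ f (ht (Set.mem_insert _ _)) (fun i => TVal M S1 v (ts i))
    change FunM M S1 f (fun i => TVal M S1 v (ts i)) = FunM M S2 f (fun i => TVal M S2 v (ts i))
    rw [hf]
    congr 1
    exact funext hi

theorem AgreeOn.realize_bf {L : FirstOrder.Language.{0, 0}} {M : Type} {S1 S2 : L.Structure M}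
    {F : Set (Sym L)} (h : AgreeOn M S1 S2 F) {α : Type} {k : ℕ} (φ : L.BoundedFormula α k)
    (hφ : bfSyms φ ⊆ F) (v : α → M) (xs : Fin k → M) :
    @BoundedFormula.Realize L M S1 α k φ v xs ↔ @BoundedFormula.Realize L M S2 α k φ v xs := by
  induction φ with
  | falsum => exact Iff.rfl
  | equal t u =>
    change TVal M S1 (Sum.elim v xs) t = TVal M S1 (Sum.elim v xs) u ↔
      TVal M S2 (Sum.elim v xs) t = TVal M S2 (Sum.elim v xs) u
    rw [h.tVal_eq _ t (Set.subset_union_left.trans hφ),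
      h.tVal_eq _ u (Set.subset_union_right.trans hφ)]
  | rel R ts =>
    change RelM M S1 R (fun i => TVal M S1 (Sum.elim v xs) (ts i)) ↔
      RelM M S2 R (fun i => TVal M S2 (Sum.elim v xs) (ts i))
    rw [h.2]
    have : ∀ i, TVal M S1 (Sum.elim v xs) (ts i) = TVal M S2 (Sum.elim v xs) (ts i) := fun i =>
      h.tVal_eq _ _ ((Set.subset_iUnion (fun i => termSyms (ts i)) i).trans hφ)
    simp only [this]
  | imp φ ψ ih1 ih2 =>
    exact imp_congr (ih1 (Set.subset_union_left.trans hφ) xs)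
      (ih2 (Set.subset_union_right.trans hφ) xs)
  | all φ ih => exact forall_congr' fun x => ih hφ _

theorem AgreeOn.modelsT {L : FirstOrder.Language.{0, 0}} {M : Type} {S1 S2 : L.Structure M}
    {F : Set (Sym L)} (h : AgreeOn M S1 S2 F) {T : L.Theory} (hT : theorySyms T ⊆ F)
    (hm : ModelsT M S1 T) : ModelsT M S2 T := fun φ hφ =>
  (h.realize_bf φ ((Set.subset_biUnion_of_mem (u := fun s => sentSyms s) hφ).trans hT) _ _).1
    (hm φ hφ)

theorem Lit.subset_syms {L : FirstOrder.Language.{0, 0}} {α : Type} {l : Lit L α}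
    {t : L.Term α} (ht : t ∈ l.terms) : termSyms t ⊆ l.syms :=
  Set.subset_biUnion_of_mem (u := fun t => termSyms t) ht

theorem AgreeOn.realize_lit {L : FirstOrder.Language.{0, 0}} {M : Type} {S1 S2 : L.Structure M}
    {F : Set (Sym L)} (h : AgreeOn M S1 S2 F) {α : Type} (l : Lit L α) (hl : l.syms ⊆ F)
    (v : α → M) : l.Realize M S1 v ↔ l.Realize M S2 v := by
  have key : ∀ t ∈ l.terms, TVal M S1 v t = TVal M S2 v t := fun t ht =>
    h.tVal_eq v t ((Lit.subset_syms ht).trans hl)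
  cases l with
  | eq t u => simp only [Lit.Realize, key t (Or.inl rfl), key u (Or.inr rfl)]
  | neq t u => simp only [Lit.Realize, key t (Or.inl rfl), key u (Or.inr rfl)]
  | rel R ts => simp only [Lit.Realize, h.2, fun i => key (ts i) ⟨i, rfl⟩]
  | nrel R ts => simp only [Lit.Realize, h.2, fun i => key (ts i) ⟨i, rfl⟩]

theorem AgreeOn.modelsK {L : FirstOrder.Language.{0, 0}} {M : Type} {S1 S2 : L.Structure M}
    {F : Set (Sym L)} (h : AgreeOn M S1 S2 F) {K : Set (Clause L)} (hK : ClausesSyms K ⊆ F)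
    (hm : ModelsK M S1 K) : ModelsK M S2 K := fun C hC v => by
  obtain ⟨l, hl, hr⟩ := hm C hC v
  refine ⟨l, hl, (h.realize_lit l (fun p hp => hK ?_) v).1 hr⟩
  exact Set.mem_biUnion hC (Set.mem_biUnion hl hp)

theorem tVal_subst {L : FirstOrder.Language.{0, 0}} {M : Type} (S : L.Structure M)
    {α β : Type} (σ : α → L.Term β) (v : β → M) (t : L.Term α) :
    TVal M S v (t.subst σ) = TVal M S (fun a => TVal M S v (σ a)) t := by
  let := S
  exact Term.realize_subst

theorem Lit.realize_subst {L : FirstOrder.Language.{0, 0}} {M : Type} (S : L.Structure M)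
    {α β : Type} (σ : α → L.Term β) (v : β → M) (l : Lit L α) :
    (l.subst σ).Realize M S v ↔ l.Realize M S (fun a => TVal M S v (σ a)) := by
  cases l <;> simp only [Lit.subst, Lit.Realize, tVal_subst]

theorem ModelsK.modelsG_instancesIn {L : FirstOrder.Language.{0, 0}} {M : Type}
    {S : L.Structure M} {K : Set (Clause L)} (h : ModelsK M S K) (F : Set (Sym L))
    (Tt : Set (GTerm L)) : ModelsG M S (instancesIn F K Tt) := by
  rintro _ ⟨C, hC, σ, rfl, -⟩
  obtain ⟨l, hl, hr⟩ := h C hC (fun a => TVal M S (fun e : Empty => e.elim) (σ a))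
  exact ⟨l.subst σ, List.mem_map_of_mem hl, (Lit.realize_subst S σ _ l).2 hr⟩

theorem instancesIn_mono {L : FirstOrder.Language.{0, 0}} (F : Set (Sym L)) (K : Set (Clause L))
    {Tt Tt' : Set (GTerm L)} (h : Tt ⊆ Tt') : instancesIn F K Tt ⊆ instancesIn F K Tt' := by
  rintro _ ⟨C, hC, σ, rfl, ht⟩
  exact ⟨C, hC, σ, rfl, fun t h1 h2 => h (ht t h1 h2)⟩

theorem termSyms_subst_subset {L : FirstOrder.Language.{0, 0}} {α β : Type}
    (σ : α → L.Term β) (t : L.Term α) :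
    termSyms (t.subst σ) ⊆ termSyms t ∪ ⋃ a, termSyms (σ a) := by
  induction t with
  | var a => exact (Set.subset_iUnion (fun a => termSyms (σ a)) a).trans Set.subset_union_right
  | func f ts ih =>
    intro p hp
    rcases hp with rfl | hp
    · exact Or.inl (Or.inl rfl)
    · obtain ⟨i, hi⟩ := Set.mem_iUnion.1 hp
      exact (ih i hi).imp_left fun h => Or.inr (Set.mem_iUnion.2 ⟨i, h⟩)

theorem Lit.syms_subst_subset {L : FirstOrder.Language.{0, 0}} {α β : Type}
    (σ : α → L.Term β) (l : Lit L α) :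
    (l.subst σ).syms ⊆ l.syms ∪ ⋃ a, termSyms (σ a) := by
  have key : ∀ t ∈ l.terms, termSyms (t.subst σ) ⊆ l.syms ∪ ⋃ a, termSyms (σ a) := fun t ht =>
    (termSyms_subst_subset σ t).trans (Set.union_subset_union_left _ (Lit.subset_syms ht))
  refine Set.iUnion₂_subset fun t ht => ?_
  cases l with
  | eq u u' =>
    rcases ht with rfl | rfl
    exacts [key u (Or.inl rfl), key u' (Or.inr rfl)]
  | neq u u' =>
    rcases ht with rfl | rfl
    exacts [key u (Or.inl rfl), key u' (Or.inr rfl)]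
  | rel R ts =>
    obtain ⟨i, rfl⟩ := ht
    exact key (ts i) ⟨i, rfl⟩
  | nrel R ts =>
    obtain ⟨i, rfl⟩ := ht
    exact key (ts i) ⟨i, rfl⟩

/-- The complementary literal. -/
def Lit.compl {L : FirstOrder.Language.{0, 0}} {α : Type} : Lit L α → Lit L α
  | eq t u => neq t u
  | neq t u => eq t u
  | rel R ts => nrel R ts
  | nrel R ts => rel R ts

theorem Lit.realize_compl {L : FirstOrder.Language.{0, 0}} {M : Type} (S : L.Structure M)
    {α : Type} (v : α → M) (l : Lit L α) : l.compl.Realize M S v ↔ ¬ l.Realize M S v := by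
  cases l <;> simp [Lit.compl, Lit.Realize]

theorem Lit.syms_compl {L : FirstOrder.Language.{0, 0}} {α : Type} (l : Lit L α) :
    l.compl.syms = l.syms := by
  cases l <;> rfl

/-- A literal as a first-order formula. -/
def Lit.toFormula {L : FirstOrder.Language.{0, 0}} {α : Type} : Lit L α → L.Formula α
  | eq t u => t.equal u
  | neq t u => (t.equal u).not
  | rel R ts => R.formula ts
  | nrel R ts => (R.formula ts).not

theorem Lit.realize_toFormula {L : FirstOrder.Language.{0, 0}} {M : Type} (S : L.Structure M)
    {α : Type} (v : α → M) (l : Lit L α) :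
    l.toFormula.Realize v ↔ l.Realize M S v := by
  cases l <;> simp only [Lit.toFormula, Lit.Realize, Formula.realize_not, Formula.realize_equal,
    Formula.realize_rel] <;> rfl

/-- A clause as a first-order sentence. -/
noncomputable def Clause.toSentence {L : FirstOrder.Language.{0, 0}} (C : Clause L) :
    L.Formula Empty :=
  Formula.iAlls (Fin C.nvars)
    (((C.lits.map Lit.toFormula).foldr (· ⊔ ·) (⊥ : L.Formula (Fin C.nvars))).relabel
      (Sum.inr : Fin C.nvars → Empty ⊕ Fin C.nvars))

theorem Clause.realize_toSentence {L : FirstOrder.Language.{0, 0}} {M : Type}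
    (S : L.Structure M) (v : Empty → M) (C : Clause L) :
    C.toSentence.Realize v ↔ ClauseHolds M S C := by
  rw [Clause.toSentence, Formula.realize_iAlls]
  refine forall_congr' fun w => ?_
  rw [Formula.realize_relabel, Sum.elim_comp_inr]
  refine (BoundedFormula.realize_foldr_sup _ w default).trans ?_
  simp only [List.mem_map, exists_exists_and_eq_and]
  exact exists_congr fun l => and_congr_right fun _ => Lit.realize_toFormula S w l

theorem ModelsT.of_elementaryEmbedding {L : FirstOrder.Language.{0, 0}} {A B : Type}
    {SA : L.Structure A} {SB : L.Structure B} (e : A ↪ₑ[L] B) {T : L.Theory}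
    (h : ModelsT A SA T) : ModelsT B SB T := fun φ hφ => by
  have := (e.map_formula φ (fun x : Empty => x.elim)).2 (h φ hφ)
  rwa [Subsingleton.elim (⇑e ∘ fun x : Empty => x.elim) (fun x : Empty => x.elim)] at this

theorem ModelsK.of_elementaryEmbedding {L : FirstOrder.Language.{0, 0}} {A B : Type}
    {SA : L.Structure A} {SB : L.Structure B} (e : A ↪ₑ[L] B) {K : Set (Clause L)}
    (h : ModelsK A SA K) : ModelsK B SB K := fun C hC =>
  (C.realize_toSentence SB _).1 <|
    (e.map_formula C.toSentence (fun x : Empty => x.elim)).2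
      ((C.realize_toSentence SA _).2 (h C hC))

theorem gVal_constT {L : FirstOrder.Language.{0, 0}} {M : Type} (S : L.Structure M)
    (c : L.Functions 0) (x : Fin 0 → M) : GVal M S (constT c) = FunM M S c x := by
  change FunM M S c _ = _
  congr 1
  exact Subsingleton.elim _ _

theorem elementaryEmbedding_map_funM {L : FirstOrder.Language.{0, 0}} {A B : Type}
    {SA : L.Structure A} {SB : L.Structure B} (e : A ↪ₑ[L] B) {n : ℕ} (f : L.Functions n)
    (x : Fin n → A) : e (FunM A SA f x) = FunM B SB f (fun i => e (x i)) :=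
  e.map_fun f x

theorem elementaryEmbedding_map_gVal_constT {L : FirstOrder.Language.{0, 0}} {A B : Type}
    {SA : L.Structure A} {SB : L.Structure B} (e : A ↪ₑ[L] B) (c : L.Functions 0) :
    e (GVal A SA (constT c)) = GVal B SB (constT c) := by
  rw [gVal_constT SA c (fun i => i.elim0), elementaryEmbedding_map_funM e, gVal_constT SB c]

/-- The sublanguage with function symbols from `F` and all relation symbols. -/
def subLang {L : FirstOrder.Language.{0, 0}} (F : Set (Sym L)) : FirstOrder.Language.{0, 0} :=
  ⟨fun n => {f : L.Functions n // (⟨n, f⟩ : Sym L) ∈ F}, L.Relations⟩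

/-- The inclusion of the sublanguage. -/
def subLangIncl {L : FirstOrder.Language.{0, 0}} (F : Set (Sym L)) : subLang F →ᴸ L :=
  ⟨fun _ f => f.1, fun _ r => r⟩

theorem termSyms_onTerm_subLangIncl {L : FirstOrder.Language.{0, 0}} (F : Set (Sym L))
    {α : Type} (t : (subLang F).Term α) : termSyms ((subLangIncl F).onTerm t) ⊆ F := by
  induction t with
  | var a => exact Set.empty_subset _
  | func f ts ih =>
    exact Set.insert_subset f.2 (Set.iUnion_subset ih)

theorem bfSyms_onBoundedFormula_subLangIncl {L : FirstOrder.Language.{0, 0}} (F : Set (Sym L))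
    {α : Type} {k : ℕ} (φ : (subLang F).BoundedFormula α k) :
    bfSyms ((subLangIncl F).onBoundedFormula φ) ⊆ F := by
  induction φ with
  | falsum => exact Set.empty_subset _
  | equal t u =>
    exact Set.union_subset (termSyms_onTerm_subLangIncl F t) (termSyms_onTerm_subLangIncl F u)
  | rel R ts => exact Set.iUnion_subset fun i => termSyms_onTerm_subLangIncl F (ts i)
  | imp φ ψ ih1 ih2 => exact Set.union_subset ih1 ih2
  | all φ ih => exact ih

theorem realize_iff_of_isQF {L : FirstOrder.Language.{0, 0}} {A B : Type} (SA : L.Structure A)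
    (SB : L.Structure B) {F : Set (Sym L)} {α : Type} {k : ℕ} {v : α → A} {w : α → B}
    {xs : Fin k → A} {ys : Fin k → B}
    (H : ∀ l : Lit L (α ⊕ Fin k), l.syms ⊆ F →
      (l.Realize A SA (Sum.elim v xs) ↔ l.Realize B SB (Sum.elim w ys)))
    {ψ : L.BoundedFormula α k} (hψ : ψ.IsQF) (hF : bfSyms ψ ⊆ F) :
    ψ.Realize v xs ↔ ψ.Realize w ys := by
  induction hψ with
  | falsum => exact Iff.rfl
  | of_isAtomic h =>
    cases h with
    | equal t u =>
      refine H (Lit.eq t u) ((Set.iUnion₂_subset ?_).trans hF)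
      rintro s (rfl | rfl)
      exacts [Set.subset_union_left, Set.subset_union_right]
    | rel R ts =>
      refine H (Lit.rel R ts) ((Set.iUnion₂_subset ?_).trans hF)
      rintro _ ⟨i, rfl⟩
      exact Set.subset_iUnion (fun i => termSyms (ts i)) i
  | imp _ _ ih1 ih2 =>
    exact imp_congr (ih1 (Set.subset_union_left.trans hF))
      (ih2 (Set.subset_union_right.trans hF))

theorem exists_formula_fin {L : FirstOrder.Language.{0, 0}} {I : Type} (φ : L.Formula I) :
    ∃ (m : ℕ) (φ' : L.Formula (Fin m)) (g : Fin m → I),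
      ∀ (M : Type) [L.Structure M] (v : I → M), φ.Realize v ↔ φ'.Realize (v ∘ g) := by
  classical
  let e := φ.freeVarFinset.equivFin
  refine ⟨_, Formula.relabel e (φ.restrictFreeVar id), fun i => (e.symm i).1,
    fun M _ v => ?_⟩
  rw [Formula.realize_relabel]
  refine (BoundedFormula.realize_restrictFreeVar v fun a => ?_).symm
  simp

theorem HasQE.sameType {L : FirstOrder.Language.{0, 0}} {T0 : L.Theory} {F0 : Set (Sym L)}
    (hqe : HasQE T0 F0) {A B : Type} [Nonempty A] [Nonempty B] (SA : L.Structure A)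
    (SB : L.Structure B) (hA : ModelsT A SA T0) (hB : ModelsT B SB T0) (C : Set (L.Functions 0))
    (H : ∀ l : Lit L Empty, l.syms ⊆ F0 ∪ (fun c => ⟨0, c⟩) '' C →
      l.Realize A SA (fun e => e.elim) → l.Realize B SB (fun e => e.elim)) :
    SameType (subLangIncl F0) (fun c : C => GVal A SA (constT c.1))
      (fun c : C => GVal B SB (constT c.1)) := by
  intro φ
  obtain ⟨m, φ', g, hg⟩ := exists_formula_fin φ
  have hred : ∀ (M : Type) (S : L.Structure M) (v : C → M),
      ((subLangIncl F0).onFormula φ).Realize v ↔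
        RealizeF M S ((subLangIncl F0).onFormula φ') (v ∘ g) := by
    intro M S v
    let := (subLangIncl F0).reduct M
    have : (subLangIncl F0).IsExpansionOn M := LHom.isExpansionOn_reduct _ _
    refine (LHom.realize_onFormula _ φ).trans ((hg M v).trans ?_)
    exact (LHom.realize_onFormula (subLangIncl F0) φ').symm
  obtain ⟨ψ, hqf, hsyms, hψ⟩ := hqe m ((subLangIncl F0).onFormula φ')
    (bfSyms_onBoundedFormula_subLangIncl F0 φ')
  rw [hred A SA, hred B SB, hψ A SA inferInstance hA, hψ B SB inferInstance hB]
  refine realize_iff_of_isQF SA SB (fun l hl => ?_) hqf hsyms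
  let σ : Fin m ⊕ Fin 0 → GTerm L := Sum.elim (fun i => constT (g i).1) (fun j => j.elim0)
  have hσ : ∀ (M : Type) (S : L.Structure M), Lit.Realize M S (Sum.elim
      ((fun c : C => GVal M S (constT c.1)) ∘ g) default) l ↔
      (l.subst σ).Realize M S (fun e => e.elim) := by
    intro M S
    rw [Lit.realize_subst]
    have : (Sum.elim ((fun c : C => GVal M S (constT c.1)) ∘ g) default : Fin m ⊕ Fin 0 → M) =
        fun a => TVal M S (fun e : Empty => e.elim) (σ a) := by
      funext a
      rcases a with i | j
      · rfl
      · exact j.elim0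
    rw [this]
  have hsub : (l.subst σ).syms ⊆ F0 ∪ (fun c => ⟨0, c⟩) '' C := by
    refine (Lit.syms_subst_subset σ l).trans (Set.union_subset_union hl ?_)
    refine Set.iUnion_subset fun a => ?_
    rcases a with i | j
    · rintro p (rfl | hp)
      · exact ⟨(g i).1, (g i).2, rfl⟩
      · obtain ⟨j, -⟩ := Set.mem_iUnion.1 hp
        exact j.elim0
    · exact j.elim0
  refine (hσ A SA).trans (Iff.trans ⟨H _ hsub, fun h => ?_⟩ (hσ B SB).symm)
  by_contra hcon
  refine (Lit.realize_compl SB _ _).1 (H _ ?_ ((Lit.realize_compl SA _ _).2 hcon)) h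
  rwa [Lit.syms_compl]

/-- Compactness for a base theory, a set of clauses and a set of ground literals. -/
theorem exists_model_of_finite {L : FirstOrder.Language.{0, 0}} (T0 : L.Theory)
    (K : Set (Clause L)) (D : Set (Lit L Empty))
    (h : ∀ D0 ⊆ D, D0.Finite → SatTKG T0 K ((fun l => [l]) '' D0)) :
    ∃ (M : Type) (_ : Nonempty M) (S : L.Structure M), ModelsT M S T0 ∧ ModelsK M S K ∧
      ∀ l ∈ D, l.Realize M S (fun e => e.elim) := by
  classical
  obtain ⟨M, hM, S, v, hv⟩ := exists_realize_of_finset_realize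
    (T0 ∪ Clause.toSentence '' K ∪ Lit.toFormula '' D : Set (L.Formula Empty)) (fun Δ hΔ => by
      obtain ⟨D0, hD0, hfin, him⟩ := (Set.exists_subset_image_finite_and
        (p := fun t => t = (Δ : Set (L.Formula Empty)) ∩ Lit.toFormula '' D)).1
        ⟨_, Set.inter_subset_right, Δ.finite_toSet.inter_of_left _, rfl⟩
      obtain ⟨M, hM, S, h1, h2, h3⟩ := h D0 hD0 hfin
      refine ⟨M, hM, S, fun e => e.elim, fun φ hφ => ?_⟩
      rcases hΔ hφ with (hT | ⟨C, hC, rfl⟩) | hl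
      · exact h1 φ hT
      · exact (C.realize_toSentence S _).2 (h2 C hC)
      · have hmem : φ ∈ Lit.toFormula '' D0 := him ▸ ⟨hφ, hl⟩
        obtain ⟨l, hl0, rfl⟩ := hmem
        obtain ⟨l', hl', hr⟩ := h3 _ ⟨l, hl0, rfl⟩
        rw [List.mem_singleton] at hl'
        subst hl'
        exact (Lit.realize_toFormula S _ _).2 hr)
  have hv0 : v = fun e => e.elim := Subsingleton.elim _ _
  subst hv0
  refine ⟨M, hM, S, fun φ hφ => hv φ (Or.inl (Or.inl hφ)), fun C hC => ?_, fun l hl => ?_⟩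
  · exact (C.realize_toSentence S _).1 (hv _ (Or.inl (Or.inr ⟨C, hC, rfl⟩)))
  · exact (Lit.realize_toFormula S _ _).1 (hv _ (Or.inr ⟨l, hl, rfl⟩))

theorem mem_subterms_self {L : FirstOrder.Language.{0, 0}} {α : Type} (t : L.Term α) :
    t ∈ subterms t := by
  cases t with
  | var a => rfl
  | func f ts => exact Or.inl rfl

theorem flatTerm_of_mem_subterms {L : FirstOrder.Language.{0, 0}} {F : Set (Sym L)} {α : Type}
    {s t : L.Term α} (hs : flatTerm F s) (ht : t ∈ subterms s) : flatTerm F t := by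
  induction s with
  | var a =>
    rw [Set.mem_singleton_iff.1 ht]
    exact hs
  | func f ts ih =>
    rcases ht with rfl | ht
    · exact hs
    · obtain ⟨i, hi⟩ := Set.mem_iUnion.1 ht
      exact ih i (hs.2 i) hi

theorem exists_mem_subterms_of_mem_termSyms {L : FirstOrder.Language.{0, 0}} {α : Type}
    {s : L.Term α} {n : ℕ} {g : L.Functions n} (h : (⟨n, g⟩ : Sym L) ∈ termSyms s) :
    ∃ ts, Term.func g ts ∈ subterms s := by
  induction s with
  | var a => exact h.elim
  | func f us ih =>
    rcases h with h | h
    · cases h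
      exact ⟨us, Or.inl rfl⟩
    · obtain ⟨i, hi⟩ := Set.mem_iUnion.1 h
      obtain ⟨ts, hts⟩ := ih i hi
      exact ⟨ts, Or.inr (Set.mem_iUnion.2 ⟨i, hts⟩)⟩

theorem mem_termSyms_of_mem_subterms {L : FirstOrder.Language.{0, 0}} {α : Type}
    {s : L.Term α} {n : ℕ} {g : L.Functions n} {ts : Fin n → L.Term α}
    (h : Term.func g ts ∈ subterms s) : (⟨n, g⟩ : Sym L) ∈ termSyms s := by
  induction s with
  | var a => cases h
  | func f us ih =>
    rcases h with h | h
    · cases h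
      exact Or.inl rfl
    · obtain ⟨i, hi⟩ := Set.mem_iUnion.1 h
      exact Or.inr (Set.mem_iUnion.2 ⟨i, ih i hi⟩)

theorem mem_varOccs_of_mem_subterms {L : FirstOrder.Language.{0, 0}} {α : Type}
    {s t : L.Term α} (h : t ∈ subterms s) {x : α} (hx : x ∈ varOccs t) : x ∈ varOccs s := by
  induction s with
  | var a =>
    rw [← Set.mem_singleton_iff.1 h]
    exact hx
  | func f us ih =>
    rcases h with rfl | h
    · exact hx
    · obtain ⟨i, hi⟩ := Set.mem_iUnion.1 h
      exact List.mem_flatMap.2 ⟨i, List.mem_finRange i, ih i hi⟩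

/-- In a flat and linear clause all of whose variables occur below `Sigd`-symbols, the symbols of
`Sigf` are constants. -/
theorem Clause.arity_eq_zero {L : FirstOrder.Language.{0, 0}} {Sigf Sigd : Set (Sym L)}
    (hdfd : Disjoint Sigf Sigd) {C : Clause L} (hflat : C.Flat (Sigf ∪ Sigd))
    (hlin : C.Linear (Sigf ∪ Sigd)) (hvars : C.VarsBelowExt Sigd) {p : Sym L}
    (hp : p ∈ C.syms) (hpf : p ∈ Sigf) : p.1 = 0 := by
  obtain ⟨n, g⟩ := p
  obtain ⟨l, hl, hp⟩ := Set.mem_iUnion₂.1 hp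
  obtain ⟨s, hs, hp⟩ := Set.mem_iUnion₂.1 hp
  obtain ⟨ts, hts⟩ := exists_mem_subterms_of_mem_termSyms hp
  by_contra hn
  obtain ⟨x, hx⟩ := (flatTerm_of_mem_subterms (hflat l hl s hs) hts).1 (Or.inl hpf)
    ⟨0, Nat.pos_of_ne_zero hn⟩
  have hocc : x ∈ varOccs (Term.func g ts) :=
    List.mem_flatMap.2 ⟨_, List.mem_finRange _, by rw [hx]; exact List.mem_singleton_self x⟩
  obtain ⟨t, ⟨hroot, hmem⟩, hxt⟩ := hvars x
    ⟨l, hl, s, hs, mem_varOccs_of_mem_subterms hts hocc⟩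
  have htext : t ∈ C.extTerms (Sigf ∪ Sigd) := by
    refine ⟨?_, hmem⟩
    cases t with
    | var a => exact hroot
    | func h us => exact Or.inr hroot
  have hgext : Term.func g ts ∈ C.extTerms (Sigf ∪ Sigd) :=
    ⟨Set.mem_union_left Sigd hpf, l, hl, s, hs, hts⟩
  have heq := hlin.1 _ hgext t htext ⟨x, hocc, hxt⟩
  rw [← heq] at hroot
  exact Set.disjoint_left.1 hdfd hpf hroot

theorem constT_injective {L : FirstOrder.Language.{0, 0}} {c d : L.Functions 0}
    (h : (constT c : GTerm L) = constT d) : c = d := by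
  unfold constT at h
  cases h
  rfl

/-- Constant arguments of extension terms of a flat clause set and the goal `f(a) ≈ b` are among
the constants `a`. -/
theorem const_arg_of_mem_estKG {L : FirstOrder.Language.{0, 0}} {F : Set (Sym L)}
    {K : Set (Clause L)} (hK : ∀ C ∈ K, C.Flat F) {n : ℕ} {f : L.Functions n}
    {a : Fin n → L.Functions 0} {b : L.Functions 0} {m : ℕ} {g : L.Functions m}
    {ts : Fin m → GTerm L} (hg : (⟨m, g⟩ : Sym L) ∈ F)
    (ht : Term.func g ts ∈
      estKG F K {[Lit.eq (Term.func f (fun i => constT (a i))) (constT b)]})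
    {i : Fin m} {c : L.Functions 0} (hc : ts i = constT c) : ∃ j, a j = c := by
  have hconst : ∀ d : L.Functions 0, Term.func g ts ∈ subterms (constT d) → False := by
    rintro d (h | h)
    · cases h
      exact i.elim0
    · obtain ⟨j, -⟩ := Set.mem_iUnion.1 h
      exact j.elim0
  rcases ht.2 with ⟨C, hC, l, hl, s, hs, hsub⟩ | ⟨C, hC, hsub⟩
  · obtain ⟨x, hx⟩ := (flatTerm_of_mem_subterms (hK C hC l hl s hs) hsub).1 hg i
    change Term.relabel Empty.elim (ts i) = Term.var x at hx
    rw [hc] at hx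
    cases hx
  · rw [Set.mem_singleton_iff.1 hC] at hsub
    obtain ⟨l, hl, hsub⟩ := Set.mem_iUnion₂.1 hsub
    rw [List.mem_singleton.1 hl] at hsub
    obtain ⟨t, ht | ht, hsub⟩ := Set.mem_iUnion₂.1 hsub
    · rw [ht] at hsub
      rcases hsub with h | h
      · cases h
        exact ⟨i, constT_injective hc⟩
      · obtain ⟨j, hj⟩ := Set.mem_iUnion.1 h
        exact (hconst _ hj).elim
    · rw [ht] at hsub
      exact (hconst _ hsub).elim

theorem argConstsOf_psiDef_subset {L : FirstOrder.Language.{0, 0}} {Sigf Sigd : Set (Sym L)}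
    {K : Set (Clause L)} (hK : ∀ C ∈ K, C.Flat (Sigf ∪ Sigd)) {n : ℕ} (f : L.Functions n)
    (a : Fin n → L.Functions 0) (b : L.Functions 0) :
    argConstsOf Sigf (psiDef Sigf Sigd (estKG (Sigf ∪ Sigd) K
      {[Lit.eq (Term.func f (fun i => constT (a i))) (constT b)]})) ⊆
      ⋃ i, {(⟨0, a i⟩ : Sym L)} := by
  rintro _ ⟨c, rfl, t, ht, m, g, ts, rfl, hg, i, hi⟩
  suffices h : ∃ j, a j = c by
    obtain ⟨j, rfl⟩ := h
    exact Set.mem_iUnion.2 ⟨j, rfl⟩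
  rcases ht with ht | ⟨t, ht, m', g', ts', rfl, hg', k, g'', sel, hg'', heq⟩
  · exact const_arg_of_mem_estKG hK (Or.inl hg) ht hi
  · cases heq
    exact const_arg_of_mem_estKG hK (Or.inr hg') ht hi

/-- Adding ground literals whose only extension symbols are constants from `Sigf` does not
enlarge the closure of the extension terms. -/
theorem psiDef_estKG_subset {L : FirstOrder.Language.{0, 0}} {Sigf Sigd : Set (Sym L)}
    (hdfd : Disjoint Sigf Sigd) {K : Set (Clause L)} {n : ℕ} {f : L.Functions n}
    (hf : (⟨n, f⟩ : Sym L) ∈ Sigd) (ts : Fin n → GTerm L) (u : GTerm L)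
    (D : Set (Lit L Empty))
    (hD : ∀ l ∈ D, ∀ p ∈ l.syms, p ∈ Sigf ∪ Sigd → p ∈ Sigf ∧ p.1 = 0)
    (G : Set (GClause L)) (hG : G ⊆ {[Lit.eq (Term.func f ts) u]} ∪ (fun l => [l]) '' D) :
    psiDef Sigf Sigd (estKG (Sigf ∪ Sigd) K G) ⊆
      psiDef Sigf Sigd (estKG (Sigf ∪ Sigd) K {[Lit.eq (Term.func f ts) u]}) := by
  set E := estKG (Sigf ∪ Sigd) K {[Lit.eq (Term.func f ts) u]} with hE
  have hfE : Term.func f ts ∈ E := by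
    refine ⟨Or.inr hf, Or.inr ⟨_, rfl, ?_⟩⟩
    exact Set.mem_biUnion (List.mem_singleton_self _)
      (Set.mem_biUnion (Or.inl rfl) (mem_subterms_self _))
  have key : ∀ t ∈ estKG (Sigf ∪ Sigd) K G, t ∈ E ∨
      ∃ (g : L.Functions 0) (us : Fin 0 → GTerm L), (⟨0, g⟩ : Sym L) ∈ Sigf ∧
        t = Term.func g us := by
    rintro t ⟨hroot, ht | ⟨C, hC, ht⟩⟩
    · exact Or.inl ⟨hroot, Or.inl ht⟩
    · rcases hG hC with hC | ⟨l, hl, rfl⟩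
      · exact Or.inl ⟨hroot, Or.inr ⟨C, hC, ht⟩⟩
      · right
        obtain ⟨l', hl', ht⟩ := Set.mem_iUnion₂.1 ht
        rw [List.mem_singleton.1 hl'] at ht
        obtain ⟨s, hs, ht⟩ := Set.mem_iUnion₂.1 ht
        cases t with
        | var e => exact e.elim
        | @func m g us =>
          obtain ⟨h1, h2⟩ := hD l hl ⟨m, g⟩
            (Lit.subset_syms hs (mem_termSyms_of_mem_subterms ht)) hroot
          have h3 : m = 0 := h2
          subst h3
          exact ⟨g, us, h1, rfl⟩
  rintro s (hs | ⟨t, ht, m, g, us, rfl, hg, hs⟩)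
  · rcases key s hs with h | ⟨g, us, hg, rfl⟩
    · exact Or.inl h
    · refine Or.inr ⟨_, hfE, n, f, ts, rfl, hf, 0, g, fun j => j.elim0, Or.inl hg, ?_⟩
      congr 1
      exact Subsingleton.elim _ _
  · rcases key _ ht with h | ⟨g', us', hg', heq⟩
    · exact Or.inr ⟨_, h, m, g, us, rfl, hg, hs⟩
    · cases heq
      exact (Set.disjoint_left.1 hdfd hg' hg).elim

/-- The structure `S2` with the symbols from `F` interpreted as in `S1`. -/
noncomputable abbrev patch {L : FirstOrder.Language.{0, 0}} {M : Type} (S1 S2 : L.Structure M)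
    (F : Set (Sym L)) : L.Structure M := by
  classical
  exact ⟨fun {n} f x => if (⟨n, f⟩ : Sym L) ∈ F then FunM M S1 f x else FunM M S2 f x,
    fun {_} r x => RelM M S2 r x⟩

theorem patch_of_mem {L : FirstOrder.Language.{0, 0}} {M : Type} (S1 S2 : L.Structure M)
    {F : Set (Sym L)} {n : ℕ} {f : L.Functions n} (hf : (⟨n, f⟩ : Sym L) ∈ F) (x : Fin n → M) :
    FunM M (patch S1 S2 F) f x = FunM M S1 f x :=
  if_pos hf

theorem patch_of_notMem {L : FirstOrder.Language.{0, 0}} {M : Type} (S1 S2 : L.Structure M)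
    {F : Set (Sym L)} {n : ℕ} {f : L.Functions n} (hf : (⟨n, f⟩ : Sym L) ∉ F) (x : Fin n → M) :
    FunM M (patch S1 S2 F) f x = FunM M S2 f x :=
  if_neg hf

/-- In two models of the theory satisfying the same literals over `F0` and the constants from
`Sigf`, `a` and `b`, the equation `f(a) ≈ b` has the same truth value if `f` is implicitly
definable over `F0 ∪ Sigf`. -/
theorem ImplicitlyDefinable.apply_eq_of_lits {L : FirstOrder.Language.{0, 0}}
    {F0 Sigf Sigd : Set (Sym L)} (hdfd : Disjoint Sigf Sigd) {T0 : L.Theory}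
    (hT0 : theorySyms T0 ⊆ F0) (hqe : HasQE T0 F0) {K : Set (Clause L)}
    (hKflat : ∀ C ∈ K, C.Flat (Sigf ∪ Sigd)) (hKlin : ∀ C ∈ K, C.Linear (Sigf ∪ Sigd))
    (hKvars : ∀ C ∈ K, C.VarsBelowExt Sigd) {n : ℕ} {f : L.Functions n}
    (hf : (⟨n, f⟩ : Sym L) ∈ Sigd) (himp : ImplicitlyDefinable T0 K (F0 ∪ Sigf) f)
    (a : Fin n → L.Functions 0) (b : L.Functions 0) {A B : Type} [Nonempty A] [Nonempty B]
    (SA : L.Structure A) (SB : L.Structure B) (hA : ModelsT A SA T0) (hAK : ModelsK A SA K)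
    (hB : ModelsT B SB T0) (hBK : ModelsK B SB K)
    (H : ∀ l : Lit L Empty,
      l.syms ⊆ F0 ∪ (fun c => ⟨0, c⟩) '' ({c | (⟨0, c⟩ : Sym L) ∈ Sigf} ∪ Set.range a ∪ {b}) →
      l.Realize A SA (fun e => e.elim) → l.Realize B SB (fun e => e.elim))
    (hfB : FunM B SB f (fun i => GVal B SB (constT (a i))) = GVal B SB (constT b)) :
    FunM A SA f (fun i => GVal A SA (constT (a i))) = GVal A SA (constT b) := by
  obtain ⟨Y, S1, S2, e1, e2, ⟨E1, hE1⟩, ⟨E2, hE2⟩, hconst, hfun, hrel⟩ :=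
    (hqe.sameType SA SB hA hB _ H).exists_joint
  have hc : ∀ c, (⟨0, c⟩ : Sym L) ∈ Sigf ∨ (∃ i, a i = c) ∨ c = b →
      GVal Y S1 (constT c) = GVal Y S2 (constT c) := by
    intro c hc
    have := hconst ⟨c, by
      rcases hc with h | h | h
      · exact Or.inl (Or.inl h)
      · exact Or.inl (Or.inr h)
      · exact Or.inr h⟩
    rw [← hE1, ← hE2] at this
    rwa [elementaryEmbedding_map_gVal_constT (SA := SA) (SB := S1) E1,
      elementaryEmbedding_map_gVal_constT (SA := SB) (SB := S2) E2] at this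
  have hfun' : ∀ (m : ℕ) (g : L.Functions m), (⟨m, g⟩ : Sym L) ∈ F0 → ∀ x : Fin m → Y,
      FunM Y S1 g x = FunM Y S2 g x := fun m g hg x => hfun m ⟨g, hg⟩ x
  have hpatch1 : AgreeOn Y S1 (patch S1 S2 Sigf) (F0 ∪ Sigf) := by
    refine ⟨fun m g hg x => ?_, fun m r x => hrel m r x⟩
    by_cases hgf : (⟨m, g⟩ : Sym L) ∈ Sigf
    · rw [patch_of_mem S1 S2 hgf]
    · rw [patch_of_notMem S1 S2 hgf]
      exact hfun' m g (hg.resolve_right hgf) x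
  have hpatch2 : AgreeOn Y S2 (patch S1 S2 Sigf) (F0 ∪ ClausesSyms K) := by
    refine ⟨fun m g hg x => ?_, fun m r x => Iff.rfl⟩
    by_cases hgf : (⟨m, g⟩ : Sym L) ∈ Sigf
    · rw [patch_of_mem S1 S2 hgf]
      rcases hg with hg | hg
      · exact (hfun' m g hg x).symm
      · obtain ⟨C, hC, hg⟩ := Set.mem_iUnion₂.1 hg
        have hm : m = 0 :=
          C.arity_eq_zero hdfd (hKflat C hC) (hKlin C hC) (hKvars C hC) hg hgf
        subst hm
        rw [← gVal_constT S1 g x, ← gVal_constT S2 g x]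
        exact (hc g (Or.inl hgf)).symm
    · rw [patch_of_notMem S1 S2 hgf]
  have h2T : ModelsT Y S2 T0 := hB.of_elementaryEmbedding E2
  have h2K : ModelsK Y S2 K := hBK.of_elementaryEmbedding E2
  have hY : Nonempty Y := ‹Nonempty A›.map e1
  have key := himp Y hY S1 (patch S1 S2 Sigf) hpatch1 (hA.of_elementaryEmbedding E1)
    (hAK.of_elementaryEmbedding E1) (hpatch2.modelsT (hT0.trans Set.subset_union_left) h2T)
    (hpatch2.modelsK Set.subset_union_right h2K) (fun i => GVal Y S1 (constT (a i)))
  rw [patch_of_notMem S1 S2 (fun h => Set.disjoint_left.1 hdfd h hf)] at key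
  have hf2 := congrArg E2 hfB
  rw [elementaryEmbedding_map_funM (SA := SB) (SB := S2) E2] at hf2
  simp only [elementaryEmbedding_map_gVal_constT (SA := SB) (SB := S2) E2] at hf2
  refine (@ElementaryEmbedding.injective L A Y SA S1 E1) ?_
  rw [elementaryEmbedding_map_funM (SA := SA) (SB := S1) E1]
  simp only [elementaryEmbedding_map_gVal_constT (SA := SA) (SB := S1) E1]
  rw [key, hc b (Or.inr (Or.inr rfl)), ← hf2]
  congr 1
  exact funext fun i => hc (a i) (Or.inr (Or.inl ⟨i, rfl⟩))

/-- Theorem `thm:definability`.  Let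
`T0 ⊆ T0 ∪ UIF_{Σf} ⊆ T = T0 ∪ UIF_{Σf} ∪ K` be a chain of local theory extensions, `K` flat
and linear with every variable below an extension symbol of `Σd`, and let `f ∈ Σd` be
implicitly definable w.r.t. `T` over `Π0 ∪ Σf`.  Let `F_f` be obtained by applying
Algorithm 1 to `G = {f(a₁,…,aₙ) ≈ b}` with instantiation set `Ψ(est(G))` (eliminating the
symbols of `Σd`; output `Γ`), followed by `(T0 ∪ UIF_{Σf})`-uniform interpolation w.r.t.
`{a₁,…,aₙ, b}`.  Then `F_f` is an explicit definition of `f`: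
`T ⊨ ∀ x̄ y (f(x̄) ≈ y ↔ F_f(x̄, y))` — equivalently, since the constants `ā`, `b` are
fresh, in every model of `T` (with any values of `ā`, `b`): `f(ā) = b ↔ F_f`. -/
theorem implicit_to_explicit_definition
    (L : FirstOrder.Language.{0, 0})
    (F0 Sigf Sigd CC : Set (Sym L))
    (hd01 : Disjoint F0 (Sigf ∪ Sigd)) (hd02 : Disjoint F0 CC)
    (hd12 : Disjoint (Sigf ∪ Sigd) CC) (hdfd : Disjoint Sigf Sigd)
    (hcover : F0 ∪ (Sigf ∪ Sigd) ∪ CC = Set.univ)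
    (hCC0 : ∀ p ∈ CC, p.1 = 0)
    (T0 : L.Theory) (hT0 : theorySyms T0 ⊆ F0) (hqe : HasQE T0 F0)
    (K : Set (Clause L)) (hKsyms : ClausesSyms K ⊆ F0 ∪ Sigf ∪ Sigd)
    (hKflat : ∀ C ∈ K, C.Flat (Sigf ∪ Sigd)) (hKlin : ∀ C ∈ K, C.Linear (Sigf ∪ Sigd))
    (hKvars : ∀ C ∈ K, C.VarsBelowExt Sigd)
    -- the chain of local theory extensions (in particular the induced `Ψ`-locality):
    (hloc : LocalExt2 Sigd T0 ∅ K)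
    (hpsiloc : PsiLocalExt (Sigf ∪ Sigd) T0 K (psiDef Sigf Sigd))
    -- `f ∈ Σd` is implicitly definable w.r.t. `T` over `Π0 ∪ Σf`:
    (n : ℕ) (f : L.Functions n) (hf : (⟨n, f⟩ : Sym L) ∈ Sigd)
    (himp : ImplicitlyDefinable T0 K (F0 ∪ Sigf) f)
    -- fresh constants `a₁, …, aₙ, b`:
    (a : Fin n → L.Functions 0) (b : L.Functions 0)
    (ha : ∀ i, (⟨0, a i⟩ : Sym L) ∈ CC) (hb : (⟨0, b⟩ : Sym L) ∈ CC)
    (hainj : Function.Injective a) (hab : ∀ i, a i ≠ b)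
    -- `Γ` is the output of Algorithm 1 on `G = {f(ā) ≈ b}` with instantiation set `Ψ(est(G))`:
    (Γ : L.Sentence)
    (hΓ : AlgOneOutput (Sigf ∪ Sigd) T0 K
            {[Lit.eq (Term.func f (fun i => constT (a i))) (constT b)]}
            (psiDef Sigf Sigd
              (estKG (Sigf ∪ Sigd) K
                {[Lit.eq (Term.func f (fun i => constT (a i))) (constT b)]}))
            (F0 ∪ Sigf ∪ (⋃ i, {(⟨0, a i⟩ : Sym L)}) ∪ {(⟨0, b⟩ : Sym L)} ∪
              argConstsOf Sigf
                (psiDef Sigf Sigd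
                  (estKG (Sigf ∪ Sigd) K
                    {[Lit.eq (Term.func f (fun i => constT (a i))) (constT b)]})))
            Γ)
    -- `F_f` is the `(T0 ∪ UIF_{Σf})`-uniform interpolant of `Γ` w.r.t. `{a₁,…,aₙ, b}`:
    (Ff : L.Sentence)
    (hFfui : IsUI T0 ∅ CC ((⋃ i, {(⟨0, a i⟩ : Sym L)}) ∪ {(⟨0, b⟩ : Sym L)}) Γ Ff)
    (hFfsyms : sentSyms Ff ⊆ F0 ∪ Sigf ∪ (⋃ i, {(⟨0, a i⟩ : Sym L)}) ∪ {(⟨0, b⟩ : Sym L)}) :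
    -- `F_f` is an explicit definition of `f` :
    ∀ (M : Type) (S : L.Structure M), Nonempty M → ModelsT M S T0 → ModelsK M S K →
      (FunM M S f (fun i => GVal M S (constT (a i))) = GVal M S (constT b) ↔
        RealizeSent M S Ff) := by
  intro M S hM hS hSK
  set G0 : Set (GClause L) :=
    {[Lit.eq (Term.func f (fun i => constT (a i))) (constT b)]} with hG0
  set Tt := psiDef Sigf Sigd (estKG (Sigf ∪ Sigd) K G0) with hTt
  have hempty : ∀ (N : Type) (SN : L.Structure N), ModelsK N SN ∅ := fun N SN C hC => hC.elim
  constructor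
  · intro hfab
    refine hFfui.2.2.1 M S hM hS (hempty M S) ((hΓ.2.2 M S hM hS).2
      ⟨S, ⟨fun _ _ _ _ => rfl, fun _ _ _ => Iff.rfl⟩, hSK.modelsG_instancesIn _ _, ?_⟩)
    intro C hC
    rw [Set.mem_singleton_iff.1 hC]
    exact ⟨_, List.mem_singleton_self _, hfab⟩
  · intro hFf
    have hargs := argConstsOf_psiDef_subset hKflat f a b
    have hΓS : RealizeSent M S Γ := by
      refine hFfui.2.2.2 Γ hΓ.1 ?_ (fun _ _ _ _ _ h => h) M S hM hS (hempty M S) hFf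
      rintro p ⟨⟨hp, -⟩, hpC⟩
      rcases hΓ.2.1 hp with (((hp | hp) | hp) | hp) | hp
      · exact (Set.disjoint_left.1 hd02 hp hpC).elim
      · exact (Set.disjoint_left.1 hd12 (Or.inl hp) hpC).elim
      · exact Or.inl hp
      · exact Or.inr hp
      · exact Or.inl (hargs hp)
    obtain ⟨S', hag, hinst, hSG⟩ := (hΓ.2.2 M S hM hS).1 hΓS
    set F1 : Set (Sym L) :=
      F0 ∪ (fun c => ⟨0, c⟩) '' ({c | (⟨0, c⟩ : Sym L) ∈ Sigf} ∪ Set.range a ∪ {b}) with hF1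
    have hag1 : AgreeOn M S S' F1 := by
      refine hag.mono ?_
      rintro p (hp | ⟨c, (hc | ⟨i, rfl⟩) | hc, rfl⟩)
      · exact Or.inl (Or.inl (Or.inl (Or.inl hp)))
      · exact Or.inl (Or.inl (Or.inl (Or.inr hc)))
      · exact Or.inl (Or.inl (Or.inr (Set.mem_iUnion.2 ⟨i, rfl⟩)))
      · rw [Set.mem_singleton_iff.1 hc]
        exact Or.inl (Or.inr rfl)
    have hext : ∀ p ∈ F1, p ∈ Sigf ∪ Sigd → p ∈ Sigf ∧ p.1 = 0 := by
      rintro p (hp | ⟨c, (hc | ⟨i, rfl⟩) | hc, rfl⟩) hps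
      · exact (Set.disjoint_left.1 hd01 hp hps).elim
      · exact ⟨hc, rfl⟩
      · exact (Set.disjoint_left.1 hd12 hps (ha i)).elim
      · rw [Set.mem_singleton_iff.1 hc] at hps
        exact (Set.disjoint_left.1 hd12 hps hb).elim
    set D : Set (Lit L Empty) :=
      {l | l.syms ⊆ F1 ∧ l.Realize M S (fun e => e.elim)} with hD
    obtain ⟨N, hN, SN, hNT, hNK, hNl⟩ := exists_model_of_finite T0 K
      (insert (Lit.eq (Term.func f (fun i => constT (a i))) (constT b)) D) (by
        intro D0 hD0 hfin
        by_contra hcon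
        refine (hpsiloc ((fun l => [l]) '' D0) (hfin.image _)).1 hcon
          ⟨M, hM, S', hag1.modelsT (hT0.trans Set.subset_union_left) hS, hempty M S', ?_⟩
        rintro C (hC | ⟨l, hl, rfl⟩)
        · refine hinst C (instancesIn_mono _ _ ?_ hC)
          refine psiDef_estKG_subset hdfd hf _ _ D (fun l hl p hp => hext p (hl.1 hp)) _ ?_
          rintro _ ⟨l, hl, rfl⟩
          rcases hD0 hl with rfl | hl
          · exact Or.inl rfl
          · exact Or.inr ⟨l, hl, rfl⟩
        · rcases hD0 hl with rfl | hl
          · exact hSG _ rfl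
          · exact ⟨l, List.mem_singleton_self l, (hag1.realize_lit l hl.1 _).1 hl.2⟩)
    exact himp.apply_eq_of_lits hdfd hT0 hqe hKflat hKlin hKvars hf a b S SN hS hSK hNT hNK
      (fun l hl hr => hNl l (Or.inr ⟨hl, hr⟩)) (hNl _ (Or.inl rfl))

end PaperSE
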